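/- arXiv:2603.26289 — 2 statements merged into one kernel-verified Lean document; each statement's English description precedes it below -/
import Mathlib

section
/- Let k be a field and A, B integral k-domains of transcendence degree 1 over k such that A^{[n]} ≅_k B^{[n]} for some n ≥ 1, identified as equal. If A is not isomorphic to a polynomial ring over a field, then A = B. -/
universe u v

namespace StrongInvariance

section CoefficientRings

variable {ι : Type*} {Ω : Type*} [Field Ω]

/-- The polynomials over `Ω` all of whose coefficients lie in the subring `A`. -/
noncomputable def coeffRing (ι : Type*) (A : Subring Ω) : Subring (MvPolynomial ι Ω) :=
  (MvPolynomial.map A.subtype).range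

theorem mem_coeffRing {A : Subring Ω} {p : MvPolynomial ι Ω} :
    p ∈ coeffRing ι A ↔ ∀ m, p.coeff m ∈ A := by
  have h := MvPolynomial.mem_range_map_iff_coeffs_subset (f := A.subtype) (x := p)
  rw [coeffRing, ← SetLike.mem_coe, RingHom.coe_range, h]
  constructor
  · intro h m
    by_cases hm : p.coeff m = 0
    · rw [hm]; exact A.zero_mem
    · simpa using h (MvPolynomial.coeff_mem_coeffs m hm)
  · intro h c hc
    obtain ⟨m, -, rfl⟩ := MvPolynomial.mem_coeffs_iff.1 hc
    simpa using h m

/-- The subring `A[x]` of `Ω`. -/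
noncomputable def polyRing (x : ι → Ω) (A : Subring Ω) : Subring Ω :=
  (coeffRing ι A).map (MvPolynomial.eval x)

/-- The family `x` is algebraically independent over the subring `P`. -/
def IndepOver (P : Subring Ω) (x : ι → Ω) : Prop :=
  ∀ p ∈ coeffRing ι P, MvPolynomial.eval x p = 0 → p = 0

theorem mem_polyRing {x : ι → Ω} {A : Subring Ω} {r : Ω} :
    r ∈ polyRing x A ↔ ∃ p ∈ coeffRing ι A, MvPolynomial.eval x p = r :=
  Subring.mem_map

theorem C_mem_coeffRing {A : Subring Ω} {a : Ω} (ha : a ∈ A) :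
    MvPolynomial.C a ∈ coeffRing ι A :=
  ⟨MvPolynomial.C ⟨a, ha⟩, by simp⟩

theorem X_mem_coeffRing {A : Subring Ω} (i : ι) : MvPolynomial.X i ∈ coeffRing ι A :=
  ⟨MvPolynomial.X i, by simp⟩

theorem coeffRing_mono {A B : Subring Ω} (h : A ≤ B) : coeffRing ι A ≤ coeffRing ι B :=
  fun _ hp => mem_coeffRing.2 fun m => h (mem_coeffRing.1 hp m)

theorem polyRing_mono (x : ι → Ω) {A B : Subring Ω} (h : A ≤ B) :
    polyRing x A ≤ polyRing x B :=
  (Subring.gc_map_comap _).monotone_l (coeffRing_mono h)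

theorem le_polyRing (x : ι → Ω) (A : Subring Ω) : A ≤ polyRing x A :=
  fun a ha => mem_polyRing.2 ⟨_, C_mem_coeffRing ha, by simp⟩

theorem var_mem_polyRing (x : ι → Ω) (A : Subring Ω) (i : ι) : x i ∈ polyRing x A :=
  mem_polyRing.2 ⟨_, X_mem_coeffRing i, by simp⟩

theorem polyRing_le {x : ι → Ω} {A S : Subring Ω} (hA : A ≤ S) (hx : ∀ i, x i ∈ S) :
    polyRing x A ≤ S := by
  intro r hr
  obtain ⟨p, hp, rfl⟩ := mem_polyRing.1 hr
  rw [MvPolynomial.eval_eq]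
  exact S.sum_mem fun m _ => S.mul_mem (hA (mem_coeffRing.1 hp m))
    (S.prod_mem fun i _ => S.pow_mem (hx i) _)

theorem polyRing_sup (x : ι → Ω) (A C : Subring Ω) :
    polyRing x (A ⊔ C) = polyRing x A ⊔ C := by
  apply le_antisymm
  · exact polyRing_le (sup_le_sup_right (le_polyRing x A) C)
      fun i => le_sup_left (a := polyRing x A) (var_mem_polyRing x A i)
  · exact sup_le (polyRing_mono x le_sup_left)
      (le_trans le_sup_right (le_polyRing x (A ⊔ C)))

theorem IndepOver.eq {P : Subring Ω} {x : ι → Ω} (h : IndepOver P x) {p q : MvPolynomial ι Ω}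
    (hp : p ∈ coeffRing ι P) (hq : q ∈ coeffRing ι P)
    (hpq : MvPolynomial.eval x p = MvPolynomial.eval x q) : p = q :=
  sub_eq_zero.1 (h _ (Subring.sub_mem _ hp hq) (by rw [map_sub, hpq, sub_self]))

theorem IndepOver.coeff_mem {P A : Subring Ω} {x : ι → Ω} (h : IndepOver P x) (hA : A ≤ P)
    {p : MvPolynomial ι Ω} (hp : p ∈ coeffRing ι P)
    (hr : MvPolynomial.eval x p ∈ polyRing x A) (m : ι →₀ ℕ) : p.coeff m ∈ A := by
  obtain ⟨q, hq, hqr⟩ := mem_polyRing.1 hr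
  rw [← h.eq (coeffRing_mono hA hq) hp hqr]
  exact mem_coeffRing.1 hq m

theorem IndepOver.mem_of_mem_polyRing {P A : Subring Ω} {x : ι → Ω} (h : IndepOver P x)
    (hA : A ≤ P) {r : Ω} (hrP : r ∈ P) (hr : r ∈ polyRing x A) : r ∈ A := by
  simpa using h.coeff_mem hA (C_mem_coeffRing hrP) (p := MvPolynomial.C r) (by simpa using hr) 0

/-- Units of `P[x]` lie in `P`. -/
theorem IndepOver.mem_of_mul_eq_one {P : Subring Ω} {x : ι → Ω} (h : IndepOver P x) {u v : Ω}
    (hu : u ∈ polyRing x P) (hv : v ∈ polyRing x P) (huv : u * v = 1) : u ∈ P := by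
  obtain ⟨p, hp, rfl⟩ := mem_polyRing.1 hu
  obtain ⟨q, hq, rfl⟩ := mem_polyRing.1 hv
  have hpq : p * q = 1 := h.eq (Subring.mul_mem _ hp hq) (Subring.one_mem _) (by simpa using huv)
  obtain ⟨c, -, rfl⟩ := MvPolynomial.isUnit_iff_eq_C_of_isReduced.1 (IsUnit.of_mul_eq_one q hpq)
  simpa using mem_coeffRing.1 hp 0

/-- If `w • A₁ ⊆ A`, then `w • A₁[x] ⊆ A[x]`. -/
theorem mul_mem_polyRing {x : ι → Ω} {A A₁ : Subring Ω} {w : Ω} (hw : ∀ a ∈ A₁, w * a ∈ A)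
    {r : Ω} (hr : r ∈ polyRing x A₁) : w * r ∈ polyRing x A := by
  obtain ⟨p, hp, rfl⟩ := mem_polyRing.1 hr
  refine mem_polyRing.2 ⟨MvPolynomial.C w * p, mem_coeffRing.2 fun m => ?_, by simp⟩
  rw [MvPolynomial.coeff_C_mul]
  exact hw _ (mem_coeffRing.1 hp m)

end CoefficientRings

section Conductor

variable {ι : Type*} {Ω : Type*} [Field Ω]

/-- The conductor of `A` in `A₁`, as a set. -/
def conductor (A A₁ : Subring Ω) : Set Ω := {z | z ∈ A ∧ ∀ a ∈ A₁, z * a ∈ A}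

/-- The conductor of `A` in `A₁`, extended to an ideal of a third ring. -/
def conductorIdeal (A A₁ A' : Subring Ω) : Ideal A' :=
  Ideal.span {z | (z : Ω) ∈ conductor A A₁}

/-- Elements of the conductor of `B` in `B₁` are polynomials with coefficients in the
conductor of `A` in `A₁`. -/
theorem coeff_mem_conductor {P A A₁ B B₁ : Subring Ω} {x y : ι → Ω} (hx : IndepOver P x)
    (hA₁P : A₁ ≤ P) (hAA₁ : A ≤ A₁)
    (hR : polyRing x A = polyRing y B) (hR₁ : polyRing x A₁ = polyRing y B₁)
    {z : Ω} (hz : z ∈ conductor B B₁) :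
    ∃ p ∈ coeffRing ι A, MvPolynomial.eval x p = z ∧ ∀ m, p.coeff m ∈ conductor A A₁ := by
  have hzR : z ∈ polyRing x A := hR ▸ le_polyRing y B hz.1
  obtain ⟨p, hp, hpz⟩ := mem_polyRing.1 hzR
  refine ⟨p, hp, hpz, fun m => ⟨mem_coeffRing.1 hp m, fun a ha => ?_⟩⟩
  have hza : z * a ∈ polyRing x A := by
    rw [hR]
    exact mul_mem_polyRing hz.2 (hR₁ ▸ le_polyRing x A₁ ha)
  have := hx.coeff_mem (hAA₁.trans hA₁P) (p := MvPolynomial.C a * p)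
    (Subring.mul_mem _ (C_mem_coeffRing (hA₁P ha)) (coeffRing_mono (hAA₁.trans hA₁P) hp))
    (by simpa [hpz, mul_comm] using hza) m
  rwa [MvPolynomial.coeff_C_mul, mul_comm] at this

theorem exists_eq_mul_of_mem_conductorIdeal {P A A₁ A' B B₁ B' : Subring Ω} {x y : ι → Ω}
    (hx : IndepOver P x) (hA₁P : A₁ ≤ P) (hAA₁ : A ≤ A₁) (hA₁A' : A₁ ≤ A')
    (hR : polyRing x A = polyRing y B) (hR₁ : polyRing x A₁ = polyRing y B₁)
    (hR' : polyRing x A' = polyRing y B')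
    (f : A') (hf : conductorIdeal A A₁ A' = Ideal.span {f})
    (h : B') (hh : h ∈ conductorIdeal B B₁ B') :
    ∃ r ∈ polyRing x A', (h : Ω) = f * r := by
  induction hh using Submodule.span_induction with
  | zero => exact ⟨0, Subring.zero_mem _, by simp⟩
  | add a b _ _ ha hb =>
    obtain ⟨r, hr, har⟩ := ha
    obtain ⟨s, hs, hbs⟩ := hb
    exact ⟨r + s, Subring.add_mem _ hr hs, by rw [mul_add, ← har, ← hbs]; rfl⟩
  | smul c b _ hb =>
    obtain ⟨s, hs, hbs⟩ := hb
    refine ⟨c * s, Subring.mul_mem _ (hR' ▸ le_polyRing y B' c.2) hs, ?_⟩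
    rw [mul_left_comm, ← hbs]; rfl
  | mem z hz =>
    obtain ⟨p, hp, hpz, hpc⟩ := coeff_mem_conductor hx hA₁P hAA₁ hR hR₁ hz
    have hdvd : ∀ m, ∃ a ∈ A', p.coeff m = f * a := by
      intro m
      have hm : (⟨p.coeff m, hA₁A' (hAA₁ (hpc m).1)⟩ : A') ∈ Ideal.span {f} :=
        hf ▸ Ideal.subset_span (hpc m)
      obtain ⟨a, ha⟩ := Ideal.mem_span_singleton'.1 hm
      exact ⟨a, a.2, by rw [mul_comm]; exact (congrArg Subtype.val ha).symm⟩
    choose a ha hpa using hdvd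
    refine ⟨∑ m ∈ p.support, a m * ∏ i ∈ m.support, x i ^ m i, ?_, ?_⟩
    · exact Subring.sum_mem _ fun m _ => Subring.mul_mem _ (le_polyRing x A' (ha m))
        (Subring.prod_mem _ fun i _ => Subring.pow_mem _ (var_mem_polyRing x A' i) _)
    · rw [← hpz, MvPolynomial.eval_eq, Finset.mul_sum]
      exact Finset.sum_congr rfl fun m _ => by rw [hpa m, mul_assoc]

/-- If `A[x] = B[y]` extends to principal ideal domains with `A'[x] = B'[y]` and
`P ∩ Q` consists of scalars, then an intermediate extension `A ⊆ A₁` with non-zero conductor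
is trivial. -/
theorem le_of_conductor_ne_zero {P Q A A₁ A' B B₁ B' : Subring Ω} {x y : ι → Ω}
    (hx : IndepOver P x) (hy : IndepOver Q y) (hA'P : A' ≤ P) (hB'Q : B' ≤ Q)
    (hAA₁ : A ≤ A₁) (hA₁A' : A₁ ≤ A') (hBB₁ : B ≤ B₁) (hB₁B' : B₁ ≤ B')
    (hR : polyRing x A = polyRing y B) (hR₁ : polyRing x A₁ = polyRing y B₁)
    (hR' : polyRing x A' = polyRing y B')
    [IsPrincipalIdealRing A'] [IsPrincipalIdealRing B']
    (hint : ∀ z ∈ A', IsIntegral A z)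
    (hPQ : ∀ z ∈ P, z ∈ Q → z⁻¹ ∈ A')
    {w : Ω} (hw : w ∈ conductor A A₁) (hw0 : w ≠ 0) : A₁ ≤ A := by
  have hA₁P := hA₁A'.trans hA'P
  have hB₁Q := hB₁B'.trans hB'Q
  obtain ⟨f, hf⟩ := (IsPrincipalIdealRing.principal (conductorIdeal A A₁ A')).principal
  obtain ⟨h, hh⟩ := (IsPrincipalIdealRing.principal (conductorIdeal B B₁ B')).principal
  rw [← Ideal.span] at hf hh
  obtain ⟨r, hr, hhr⟩ := exists_eq_mul_of_mem_conductorIdeal hx hA₁P hAA₁ hA₁A' hR hR₁ hR' f hf h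
    (hh ▸ Ideal.mem_span_singleton_self h)
  obtain ⟨s, hs, hfs⟩ := exists_eq_mul_of_mem_conductorIdeal hy hB₁Q hBB₁ hB₁B' hR.symm hR₁.symm
    hR'.symm h hh f (hf ▸ Ideal.mem_span_singleton_self f)
  have hf0 : (f : Ω) ≠ 0 := by
    intro h0
    have : (⟨w, hA₁A' (hAA₁ hw.1)⟩ : A') ∈ Ideal.span {f} := hf ▸ Ideal.subset_span hw
    obtain ⟨a, ha⟩ := Ideal.mem_span_singleton'.1 this
    exact hw0 (by simpa [h0] using (congrArg Subtype.val ha).symm)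
  have hsr : s * r = 1 := by
    have : (f : Ω) * (s * r) = f * 1 := by
      rw [mul_one, mul_comm s, ← mul_assoc, ← hhr, ← hfs]
    exact mul_left_cancel₀ hf0 this
  have hsQ : s ∈ Q := hy.mem_of_mul_eq_one (polyRing_mono y hB'Q hs)
    (polyRing_mono y hB'Q (hR' ▸ hr)) hsr
  have hfQ : (f : Ω) ∈ Q := hfs ▸ Q.mul_mem (hB'Q h.2) hsQ
  have hfinv := hPQ f (hA'P f.2) hfQ
  have htop : conductorIdeal A A₁ A' = ⊤ := by
    rw [hf, Ideal.span_singleton_eq_top]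
    exact IsUnit.of_mul_eq_one ⟨_, hfinv⟩ (Subtype.ext (mul_inv_cancel₀ hf0))
  let I : Ideal A :=
    { carrier := {z | ∀ a ∈ A₁, (z : Ω) * a ∈ A}
      add_mem' := fun ha hb c hc => by
        simpa [add_mul] using A.add_mem (ha c hc) (hb c hc)
      zero_mem' := fun a _ => by simp
      smul_mem' := fun c z hz a ha => by
        simpa [mul_assoc] using A.mul_mem c.2 (hz a ha) }
  have hAA' : A ≤ A' := hAA₁.trans hA₁A'
  have hI : I.map (Subring.inclusion hAA') = ⊤ := by
    rw [← top_le_iff, ← htop]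
    exact Ideal.span_le.2 fun z hz =>
      Ideal.mem_map_of_mem (Subring.inclusion hAA') (show (⟨z, hz.1⟩ : A) ∈ I from hz.2)
  have hint' : (Subring.inclusion hAA').IsIntegral := by
    intro z
    obtain ⟨p, hp, hpz⟩ := hint z z.2
    refine ⟨p, hp, Subtype.ext ?_⟩
    rw [← A'.subtype_apply, Polynomial.hom_eval₂]
    exact hpz
  rw [Ideal.map_eq_top_iff _ (Subring.inclusion_injective _) hint'] at hI
  intro a ha
  have h1 : (1 : A) ∈ I := hI ▸ Submodule.mem_top
  simpa using h1 a ha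

/-- Adjoining an integral element of the fraction field gives a non-zero conductor. -/
theorem exists_mem_conductor_of_isIntegral {A : Subring Ω} {c w : Ω} (hc : IsIntegral A c)
    (hw : w ∈ A) (hw0 : w ≠ 0) (hwc : w * c ∈ A) :
    ∃ w' ∈ conductor A (A ⊔ Subring.closure {c}), w' ≠ 0 := by
  obtain ⟨p, hp, hpc⟩ := hc
  have hpow : ∀ i j, i ≤ j → w ^ j * c ^ i ∈ A := by
    intro i j hij
    obtain ⟨d, rfl⟩ := Nat.exists_eq_add_of_le hij
    rw [pow_add, mul_right_comm, ← mul_pow]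
    exact A.mul_mem (A.pow_mem hwc i) (A.pow_mem hw d)
  have hmul : ∀ q : Polynomial A, w ^ p.natDegree * q.eval₂ A.subtype c ∈ A := by
    intro q
    have hmod : q.eval₂ A.subtype c = (q %ₘ p).eval₂ A.subtype c := by
      conv_lhs => rw [← Polynomial.modByMonic_add_div q p, Polynomial.eval₂_add,
        Polynomial.eval₂_mul]
      have : p.eval₂ A.subtype c = 0 := hpc
      rw [this, zero_mul, add_zero]
    rw [hmod, Polynomial.eval₂_eq_sum_range, Finset.mul_sum]
    refine A.sum_mem fun i hi => ?_
    rw [mul_left_comm]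
    refine A.mul_mem (Subtype.prop _) (hpow _ _ ?_)
    exact (Nat.lt_succ_iff.1 (Finset.mem_range.1 hi)).trans
      (Polynomial.natDegree_modByMonic_le q hp)
  have hle : A ⊔ Subring.closure {c} ≤ (Polynomial.eval₂RingHom A.subtype c).range := by
    refine sup_le (fun a ha => ⟨Polynomial.C ⟨a, ha⟩, by simp⟩) ?_
    rw [Subring.closure_le, Set.singleton_subset_iff]
    exact ⟨Polynomial.X, by simp⟩
  refine ⟨w ^ p.natDegree, ⟨A.pow_mem hw _, fun a ha => ?_⟩, pow_ne_zero _ hw0⟩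
  obtain ⟨q, rfl⟩ := hle ha
  exact hmul q

end Conductor

section Specialization

open Polynomial in
/-- The pair `w, z` satisfies a non-trivial polynomial relation over `κ`. -/
def DependentPair (κ : Type*) {D : Type*} [Field κ] [CommRing D] [Algebra κ D] (w z : D) : Prop :=
  ∃ q : κ[X][X], q ≠ 0 ∧ q.eval₂ (aeval w : κ[X] →ₐ[κ] D).toRingHom z = 0

variable {κ : Type*} [Field κ]

theorem DependentPair.of_injective {D E : Type*} [CommRing D] [CommRing E] [Algebra κ D]
    [Algebra κ E] (f : D →ₐ[κ] E) (hf : Function.Injective f) {w z : D}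
    (h : DependentPair κ (f w) (f z)) : DependentPair κ w z := by
  obtain ⟨q, hq, hqz⟩ := h
  refine ⟨q, hq, hf ?_⟩
  have := Polynomial.hom_eval₂ q (Polynomial.aeval w : Polynomial κ →ₐ[κ] D).toRingHom
    f.toRingHom z
  rw [map_zero, ← hqz]
  refine this.trans ?_
  congr 1
  exact Polynomial.ringHom_ext (by simp) (by simp)

/-- A quotient of a domain of transcendence degree one by a non-zero ideal is algebraic. -/
theorem DependentPair.isAlgebraic_map {D E : Type*} [CommRing D] [IsDomain D] [CommRing E]
    [Algebra κ D] [Algebra κ E] (f : D →ₐ[κ] E) {w z : D} (hz : z ≠ 0) (hfz : f z = 0)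
    (h : DependentPair κ w z) : IsAlgebraic κ (f w) := by
  obtain ⟨q, hq, hqz⟩ := h
  obtain ⟨q', hqq', hdvd⟩ := Polynomial.exists_eq_pow_rootMultiplicity_mul_and_not_dvd q hq 0
  rw [Polynomial.C_0, sub_zero] at hqq' hdvd
  have hc : q'.coeff 0 ≠ 0 := fun h0 => hdvd (Polynomial.X_dvd_iff.2 h0)
  have hq'z : q'.eval₂ (Polynomial.aeval w : Polynomial κ →ₐ[κ] D).toRingHom z = 0 := by
    rw [hqq', Polynomial.eval₂_mul, Polynomial.eval₂_pow, Polynomial.eval₂_X] at hqz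
    exact (mul_eq_zero.1 hqz).resolve_left (pow_ne_zero _ hz)
  refine ⟨q'.coeff 0, hc, ?_⟩
  have := congrArg f.toRingHom hq'z
  rw [Polynomial.hom_eval₂] at this
  change Polynomial.eval₂ _ (f z) q' = f 0 at this
  rw [hfz, Polynomial.eval₂_at_zero, map_zero] at this
  rw [Polynomial.aeval_algHom_apply]
  exact this

theorem exists_algHom_apply_ne_zero [IsAlgClosed κ] {D : Type*} [CommRing D] [IsDomain D]
    [Algebra κ D] (hD : ∀ w z : D, DependentPair κ w z) {b : D}
    (hD' : ∃ z : D, z ≠ 0 ∧ ¬ IsUnit z) (hb : ∃ c, ¬ IsUnit (b * c + 1)) :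
    ∃ χ : D →ₐ[κ] κ, χ b ≠ 0 := by
  have hbj : b ∉ (⊥ : Ideal D).jacobson := by
    rw [Ideal.mem_jacobson_bot]
    simpa using hb
  rw [Ideal.jacobson, Ideal.mem_sInf] at hbj
  push Not at hbj
  obtain ⟨m, ⟨-, hm⟩, hbm⟩ := hbj
  obtain ⟨z, hz, hz0⟩ : ∃ z ∈ m, z ≠ 0 := by
    by_contra! hcon
    obtain ⟨z, hz0, hz⟩ := hD'
    have hbot : m = ⊥ := (Submodule.eq_bot_iff m).2 hcon
    obtain ⟨m', hm', hzm'⟩ := exists_max_ideal_of_mem_nonunits hz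
    exact hz0 (by simpa [← hm.eq_of_le hm'.ne_top (hbot ▸ bot_le), hbot] using hzm')
  let _ : Field (D ⧸ m) := Ideal.Quotient.field m
  have : Algebra.IsIntegral κ (D ⧸ m) := ⟨fun v => by
    obtain ⟨w, rfl⟩ := Ideal.Quotient.mkₐ_surjective κ m v
    exact ((hD w z).isAlgebraic_map _ hz0
      (by simpa using Ideal.Quotient.eq_zero_iff_mem.2 hz)).isIntegral⟩
  let e : κ ≃ₐ[κ] (D ⧸ m) := AlgEquiv.ofBijective (Algebra.ofId κ (D ⧸ m))
    IsAlgClosed.algebraMap_bijective_of_isIntegral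
  refine ⟨e.symm.toAlgHom.comp (Ideal.Quotient.mkₐ κ m), fun h => hbm ?_⟩
  have : e.symm (Ideal.Quotient.mkₐ κ m b) = 0 := h
  rw [EmbeddingLike.map_eq_zero_iff] at this
  exact Ideal.Quotient.eq_zero_iff_mem.1 this

/-- A non-constant polynomial is non-constant on some line. -/
theorem exists_line_natDegree_ne_zero [Infinite κ] {ι : Type*} {p : MvPolynomial ι κ}
    {m : ι →₀ ℕ} (hm : m ≠ 0) (hp : p.coeff m ≠ 0) :
    ∃ l : ι → Polynomial κ, (MvPolynomial.aeval l p).natDegree ≠ 0 := by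
  classical
  obtain ⟨v, hv⟩ : ∃ v, MvPolynomial.eval v p ≠ MvPolynomial.eval 0 p := by
    by_contra! hcon
    have : p = MvPolynomial.C (MvPolynomial.eval 0 p) := MvPolynomial.funext fun v => by
      rw [hcon v, MvPolynomial.eval_C]
    rw [this, MvPolynomial.coeff_C, if_neg hm.symm] at hp
    exact hp rfl
  refine ⟨fun i => Polynomial.C (v i) * Polynomial.X, fun h => hv ?_⟩
  obtain ⟨c, hc⟩ := Polynomial.natDegree_eq_zero.1 h
  have key : ∀ t : κ, MvPolynomial.eval (fun i => v i * t) p = c := by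
    intro t
    have hcomp : (Polynomial.aeval t).comp
        (MvPolynomial.aeval fun i => Polynomial.C (v i) * Polynomial.X) =
        MvPolynomial.aeval (R := κ) fun i => v i * t :=
      MvPolynomial.algHom_ext fun i => by simp
    rw [← MvPolynomial.coe_aeval_eq_eval, RingHom.coe_coe, ← hcomp, AlgHom.comp_apply, ← hc,
      Polynomial.aeval_C, Algebra.algebraMap_self, RingHom.id_apply]
  have h1 := key 1
  have h0 := key 0
  simp only [mul_one, mul_zero] at h1 h0
  exact h1.trans h0.symm

end Specialization

section Luroth

open Polynomial IntermediateField

/-- If `α` is a root of a polynomial taking a unit value at `v`, then `(α - v)⁻¹` is integral. -/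
theorem isIntegral_inv_sub {R L : Type*} [CommRing R] [Field L] [Algebra R L] {α : L} {v : R}
    {p : R[X]} (hp : aeval α p = 0) (hv : IsUnit (p.eval v)) :
    IsIntegral R (α - algebraMap R L v)⁻¹ := by
  rcases eq_or_ne (α - algebraMap R L v) 0 with h0 | h0
  · rw [h0, inv_zero]
    exact isIntegral_zero
  obtain ⟨u, hu⟩ := hv
  have hp' : eval₂ (algebraMap R L) (α - algebraMap R L v) (taylor v p) = 0 := by
    rw [taylor_apply, eval₂_comp]
    simpa [aeval_def] using hp
  let _ := invertibleOfNonzero h0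
  refine ⟨C (↑u⁻¹ : R) * (taylor v p).reverse, ?_, ?_⟩
  · nontriviality R
    have hlead : (taylor v p).reverse.leadingCoeff = u := by
      have h1 : (taylor v p).coeff 0 ≠ 0 := by
        rw [taylor_coeff_zero, ← hu]
        exact u.ne_zero
      rw [reverse_leadingCoeff, trailingCoeff, natTrailingDegree_eq_zero.2 (Or.inr h1),
        taylor_coeff_zero, hu]
    refine monic_C_mul_of_mul_leadingCoeff_eq_one ?_
    rw [hlead, u.inv_mul]
  · rw [eval₂_mul, ← invOf_eq_inv, (eval₂_reverse_eq_zero_iff _ _ _).2 hp', mul_zero]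

variable {κ : Type*} [Field κ]

theorem exists_isCoprime_of_mem_adjoin {L : Type*} [Field L] [Algebra κ L] {α x : L}
    (hα : Transcendental κ α) (hx : x ∈ κ⟮α⟯) :
    ∃ U V : κ[X], V ≠ 0 ∧ IsCoprime U V ∧ x * aeval α V = aeval α U := by
  have hinj := transcendental_iff_injective.1 hα
  obtain ⟨r, s, rfl⟩ := (mem_adjoin_simple_iff κ x).1 hx
  rcases eq_or_ne s 0 with rfl | hs
  · exact ⟨0, 1, one_ne_zero, isCoprime_zero_left.2 isUnit_one, by simp⟩
  obtain ⟨V, U, d, hVU, rfl, rfl⟩ :=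
    UniqueFactorizationMonoid.exists_reduced_factors s hs r
  refine ⟨U, V, right_ne_zero_of_mul hs, hVU.isCoprime.symm, ?_⟩
  have hd : aeval α d ≠ 0 := fun h =>
    left_ne_zero_of_mul hs (hinj (by rw [h, map_zero]))
  have hV : aeval α V ≠ 0 := fun h =>
    right_ne_zero_of_mul hs (hinj (by rw [h, map_zero]))
  rw [map_mul, map_mul]
  field_simp

/-- Elements of `κ⟮q⟯` which are polynomials are polynomials in the polynomial `q`. -/
theorem exists_comp_of_mem_adjoin {p q : κ[X]}
    (hq : Transcendental κ (algebraMap κ[X] (RatFunc κ) q))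
    (hp : algebraMap κ[X] (RatFunc κ) p ∈ κ⟮algebraMap κ[X] (RatFunc κ) q⟯) :
    ∃ s : κ[X], p = s.comp q := by
  obtain ⟨U, V, hV0, ⟨a, b, hab⟩, h⟩ := exists_isCoprime_of_mem_adjoin hq hp
  have hinj := IsFractionRing.injective κ[X] (RatFunc κ)
  rw [aeval_algebraMap_apply, aeval_algebraMap_apply, ← map_mul] at h
  have h' : p * aeval q V = aeval q U := hinj h
  have hunit : IsUnit (aeval q V) := by
    refine IsUnit.of_mul_eq_one (aeval q a * p + aeval q b) ?_
    have := congrArg (aeval q) hab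
    rw [map_add, map_mul, map_mul, ← h', map_one] at this
    linear_combination this
  have hqd : q.natDegree ≠ 0 := by
    intro h0
    obtain ⟨c, rfl⟩ := natDegree_eq_zero.1 h0
    refine hq ?_
    rw [← algebraMap_eq, ← IsScalarTower.algebraMap_apply]
    exact isAlgebraic_algebraMap c
  have hVd : V.natDegree = 0 := by
    have h1 : (V.comp q).natDegree = 0 := natDegree_eq_zero_of_isUnit hunit
    rw [natDegree_comp] at h1
    exact (mul_eq_zero.1 h1).resolve_right hqd
  obtain ⟨c, rfl⟩ := natDegree_eq_zero.1 hVd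
  have hc : c ≠ 0 := by simpa using hV0
  refine ⟨C c⁻¹ * U, ?_⟩
  rw [mul_comp, C_comp]
  change p = C c⁻¹ * aeval q U
  rw [← h', aeval_C, algebraMap_eq, mul_comm p, ← mul_assoc, ← C_mul, inv_mul_cancel₀ hc, C_1,
    one_mul]

/-- An intermediate field of `κ(X)` which contains a non-constant polynomial is generated by
a polynomial. -/
theorem exists_polynomial_generator [IsAlgClosed κ] {E : IntermediateField κ (RatFunc κ)}
    {p : κ[X]} (hp : p.natDegree ≠ 0) (hpE : algebraMap κ[X] (RatFunc κ) p ∈ E) :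
    ∃ q : κ[X], algebraMap κ[X] (RatFunc κ) q ∈ E ∧
      ∀ a : κ[X], algebraMap κ[X] (RatFunc κ) a ∈ E → ∃ s : κ[X], a = s.comp q := by
  have hinj := IsFractionRing.injective κ[X] (RatFunc κ)
  have hE : E ≠ ⊥ := by
    rintro rfl
    obtain ⟨c, hc⟩ := mem_bot.1 hpE
    rw [IsScalarTower.algebraMap_apply κ κ[X]] at hc
    rw [← hinj hc] at hp
    exact hp (natDegree_C c)
  obtain ⟨g, hgE, hg⟩ : ∃ g, E = κ⟮g⟯ ∧ Transcendental κ g :=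
    ⟨_, RatFunc.Luroth.eq_adjoin_generator, RatFunc.Luroth.transcendental_generator hE⟩
  suffices h : ∃ q : κ[X], E = κ⟮algebraMap κ[X] (RatFunc κ) q⟯ by
    obtain ⟨q, rfl⟩ := h
    have hq : Transcendental κ (algebraMap κ[X] (RatFunc κ) q) := by
      rw [transcendental_algebraMap_iff hinj]
      by_contra hq
      have h0 : q.natDegree = 0 := by
        by_contra h0
        refine hq (q.transcendental h0 (mem_nonZeroDivisors_of_ne_zero ?_))
        rw [Ne, leadingCoeff_eq_zero]
        rintro rfl
        exact h0 natDegree_zero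
      refine hE ?_
      obtain ⟨c, rfl⟩ := natDegree_eq_zero.1 h0
      rw [adjoin_simple_eq_bot_iff, ← algebraMap_eq, ← IsScalarTower.algebraMap_apply]
      exact (⊥ : IntermediateField κ (RatFunc κ)).algebraMap_mem c
    exact ⟨q, mem_adjoin_simple_self κ _, fun a ha => exists_comp_of_mem_adjoin hq ha⟩
  have hmap : ∀ W : κ[X], aeval g (W.map C) = aeval g W := fun W =>
    aeval_map_algebraMap κ[X] g W
  obtain ⟨U, V, hV0, ⟨a, b, hab⟩, h⟩ := exists_isCoprime_of_mem_adjoin hg (hgE ▸ hpE)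
  by_cases hV : V.degree = 0
  · have : IsIntegral κ[X] g := by
      obtain ⟨c, rfl⟩ := natDegree_eq_zero.1 (natDegree_eq_of_degree_eq_some hV)
      have hc : c ≠ 0 := by simpa using hV0
      rw [aeval_C, IsScalarTower.algebraMap_apply κ κ[X], ← map_mul] at h
      have hU : U.natDegree ≠ 0 := by
        intro h0
        obtain ⟨d, rfl⟩ := natDegree_eq_zero.1 h0
        rw [aeval_C, IsScalarTower.algebraMap_apply κ κ[X] (RatFunc κ) d] at h
        have := congrArg natDegree (hinj h)
        rw [algebraMap_eq, natDegree_mul_C hc, natDegree_C] at this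
        exact hp this
      have hU0 : U.leadingCoeff⁻¹ ≠ 0 := by
        rw [Ne, inv_eq_zero, leadingCoeff_eq_zero]
        rintro rfl
        exact hU natDegree_zero
      refine IsIntegral.of_aeval_monic (p := (C U.leadingCoeff⁻¹ * U).map C)
        ((monic_C_mul_of_mul_leadingCoeff_eq_one (inv_mul_cancel₀ ?_)).map C) ?_ ?_
      · simpa using hU0
      · rwa [natDegree_map_eq_of_injective C_injective, natDegree_C_mul hU0]
      · rw [hmap, map_mul, ← h, aeval_C, IsScalarTower.algebraMap_apply κ κ[X], ← map_mul]
        exact isIntegral_algebraMap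
    obtain ⟨q, hq⟩ := IsIntegrallyClosed.isIntegral_iff.1 this
    exact ⟨q, by rw [hq, hgE]⟩
  · obtain ⟨v, hv⟩ := IsAlgClosed.exists_root V hV
    have : IsIntegral κ[X] (g - algebraMap κ[X] (RatFunc κ) (C v))⁻¹ := by
      refine isIntegral_inv_sub (p := U.map C - C p * V.map C) ?_ ?_
      · rw [map_sub, map_mul, aeval_C, hmap, hmap, ← h, sub_self]
      · have hUv : a.eval v * U.eval v = 1 := by
          simpa [hv.eq_zero] using congrArg (eval v) hab
        rw [eval_sub, eval_mul, eval_map_apply, eval_map_apply, hv.eq_zero, C_0, mul_zero, sub_zero]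
        exact isUnit_C.2 (IsUnit.of_mul_eq_one _ (by rw [mul_comm, hUv]))
    obtain ⟨q, hq⟩ := IsIntegrallyClosed.isIntegral_iff.1 this
    refine ⟨q, ?_⟩
    have hv' : algebraMap κ[X] (RatFunc κ) (C v) = algebraMap κ (RatFunc κ) v :=
      (IsScalarTower.algebraMap_apply κ κ[X] (RatFunc κ) v).symm
    rw [hq, hgE, hv']
    apply le_antisymm
    · rw [adjoin_simple_le_iff]
      have := add_mem (inv_mem (mem_adjoin_simple_self κ (g - algebraMap κ (RatFunc κ) v)⁻¹))
        (IntermediateField.algebraMap_mem κ⟮(g - algebraMap κ (RatFunc κ) v)⁻¹⟯ v)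
      simpa using this
    · rw [adjoin_simple_le_iff]
      exact inv_mem (sub_mem (mem_adjoin_simple_self κ g) (IntermediateField.algebraMap_mem _ v))

end Luroth

section Generator

variable {ι : Type*} {κ : Type*} [Field κ] {Ω : Type*} [Field Ω] [Algebra κ Ω]

theorem aeval_injective_of_indepOver {Q : Subring Ω} {y : ι → Ω} (hy : IndepOver Q y)
    {B : Subalgebra κ Ω} (hBQ : B.toSubring ≤ Q) :
    Function.Injective (MvPolynomial.aeval y : MvPolynomial ι B →ₐ[B] Ω) := by
  rw [injective_iff_map_eq_zero]
  intro p hp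
  have h1 : MvPolynomial.map (algebraMap B Ω) p ∈ coeffRing ι Q := by
    rw [mem_coeffRing]
    intro m
    rw [MvPolynomial.coeff_map]
    exact hBQ (p.coeff m).2
  have h2 := hy _ h1 (by rwa [MvPolynomial.eval_map])
  exact MvPolynomial.map_injective _ Subtype.val_injective (h2.trans (map_zero _).symm)

theorem exists_aeval_of_mem_polyRing {y : ι → Ω} {B : Subalgebra κ Ω} {r : Ω}
    (hr : r ∈ polyRing y B.toSubring) : ∃ p : MvPolynomial ι B, MvPolynomial.aeval y p = r := by
  obtain ⟨-, ⟨p, rfl⟩, rfl⟩ := mem_polyRing.1 hr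
  exact ⟨p, by rw [MvPolynomial.eval_map]; rfl⟩

/-- If `A[x] = B[y]` with `A` and `B` of transcendence degree one and sharing only the constants,
then `A` embeds into a polynomial ring in one variable. -/
theorem exists_injective_algHom_polynomial [IsAlgClosed κ] {P Q : Subring Ω} {x y : ι → Ω}
    (hx : IndepOver P x) (hy : IndepOver Q y)
    (hPQ : ∀ z ∈ P, z ∈ Q → z ∈ Set.range (algebraMap κ Ω))
    (hP : ∀ w ∈ P, ∀ z ∈ P, DependentPair κ w z) (hQ : ∀ w ∈ Q, ∀ z ∈ Q, DependentPair κ w z)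
    {A B : Subalgebra κ Ω} (hAP : A.toSubring ≤ P) (hBQ : B.toSubring ≤ Q)
    (hR : polyRing x A.toSubring = polyRing y B.toSubring)
    (hA : ∃ a ∈ A, a ∉ Set.range (algebraMap κ Ω)) (hB : ∃ b ∈ B, b ∉ Set.range (algebraMap κ Ω)) :
    ∃ ψ : A →ₐ[κ] Polynomial κ, Function.Injective ψ ∧ ∃ a, (ψ a).natDegree ≠ 0 := by
  let j : MvPolynomial ι B →ₐ[κ] Ω :=
    (MvPolynomial.aeval y : MvPolynomial ι B →ₐ[B] Ω).restrictScalars κ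
  have hj : Function.Injective j := aeval_injective_of_indepOver hy hBQ
  have hle : A ≤ j.range := fun a ha =>
    exists_aeval_of_mem_polyRing (hR ▸ le_polyRing x _ ha)
  let f : A →ₐ[κ] MvPolynomial ι B :=
    (AlgEquiv.ofInjective j hj).symm.toAlgHom.comp (Subalgebra.inclusion hle)
  have hf : ∀ a, MvPolynomial.aeval y (f a) = (a : Ω) := fun a =>
    congrArg Subtype.val ((AlgEquiv.ofInjective j hj).apply_symm_apply (Subalgebra.inclusion hle a))
  obtain ⟨a, ha, haκ⟩ := hA
  obtain ⟨m, hm, hb⟩ : ∃ m, m ≠ 0 ∧ (f ⟨a, ha⟩).coeff m ≠ 0 := by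
    by_contra! hcon
    refine haκ (hPQ a (hAP ha) ?_)
    have : f ⟨a, ha⟩ = MvPolynomial.C ((f ⟨a, ha⟩).coeff 0) := by
      classical
      ext m
      rw [MvPolynomial.coeff_C]
      split_ifs with h
      · rw [h]
      · rw [hcon m (Ne.symm h)]
    have h1 := hf ⟨a, ha⟩
    rw [this, MvPolynomial.aeval_C] at h1
    change _ = a at h1
    rw [← h1]
    exact hBQ ((f ⟨a, ha⟩).coeff 0).2
  have hBunit : ∀ u : B, IsUnit u → (u : Ω) ∈ Set.range (algebraMap κ Ω) := by
    intro u hu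
    obtain ⟨v, huv⟩ := hu.exists_right_inv
    have hBP : ∀ u : B, (u : Ω) ∈ polyRing x P := fun u =>
      polyRing_mono x hAP (hR ▸ le_polyRing y _ u.2)
    exact hPQ _ (hx.mem_of_mul_eq_one (hBP u) (hBP v) (congrArg Subtype.val huv)) (hBQ u.2)
  obtain ⟨χ, hχ⟩ : ∃ χ : B →ₐ[κ] κ, χ ((f ⟨a, ha⟩).coeff m) ≠ 0 := by
    refine exists_algHom_apply_ne_zero (fun w z => .of_injective B.val Subtype.val_injective
      (hQ _ (hBQ w.2) _ (hBQ z.2))) ?_ ?_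
    · obtain ⟨b, hb, hbκ⟩ := hB
      refine ⟨⟨b, hb⟩, fun h => hbκ ⟨0, ?_⟩, fun h => hbκ (hBunit _ h)⟩
      rw [map_zero]
      exact (congrArg Subtype.val h).symm
    · by_contra! hcon
      obtain ⟨c, hc⟩ := hBunit _ (hcon 1)
      rw [mul_one] at hc
      have hb' : (f ⟨a, ha⟩).coeff m = algebraMap κ B (c - 1) := by
        apply Subtype.val_injective
        change _ = algebraMap κ Ω (c - 1)
        rw [map_sub, hc]
        simp
      rw [hb'] at hb hcon
      have hc0 : c - 1 ≠ 0 := fun h => hb (by rw [h, map_zero])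
      have := hcon (algebraMap κ B (-(c - 1)⁻¹))
      rw [← map_mul, mul_neg, mul_inv_cancel₀ hc0, map_neg, map_one, neg_add_cancel] at this
      exact not_isUnit_zero this
  obtain ⟨l, hl⟩ := exists_line_natDegree_ne_zero hm
    (p := MvPolynomial.map χ.toRingHom (f ⟨a, ha⟩)) (by rwa [MvPolynomial.coeff_map])
  let ψ : A →ₐ[κ] Polynomial κ :=
    (MvPolynomial.aeval l).comp ((MvPolynomial.mapAlgHom χ).comp f)
  refine ⟨ψ, ?_, ⟨a, ha⟩, hl⟩
  rw [injective_iff_map_eq_zero]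
  intro z hz
  by_contra hz0
  have : DependentPair κ (⟨a, ha⟩ : A) z :=
    .of_injective A.val Subtype.val_injective (hP _ (hAP ha) _ (hAP z.2))
  have hpa : ψ ⟨a, ha⟩ ≠ 0 := by
    intro h
    change (ψ ⟨a, ha⟩).natDegree ≠ 0 at hl
    rw [h] at hl
    exact hl Polynomial.natDegree_zero
  exact (ψ ⟨a, ha⟩).transcendental hl (mem_nonZeroDivisors_of_ne_zero
    (Polynomial.leadingCoeff_ne_zero.2 hpa)) (this.isAlgebraic_map ψ hz0 hz)

/-- A subalgebra which embeds non-trivially into a polynomial ring is contained in a polynomial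
ring with the same fraction field. -/
theorem exists_le_adjoin_singleton [IsAlgClosed κ] {A : Subalgebra κ Ω}
    (ψ : A →ₐ[κ] Polynomial κ) (hψ : Function.Injective ψ) (hdeg : ∃ a, (ψ a).natDegree ≠ 0) :
    ∃ g : Ω, A ≤ Algebra.adjoin κ {g} ∧ ∃ w ∈ A, w ≠ 0 ∧ w * g ∈ A := by
  have hinj : Function.Injective (IsScalarTower.toAlgHom κ (Polynomial κ) (RatFunc κ)) :=
    IsFractionRing.injective (Polynomial κ) (RatFunc κ)
  let ψ' : A →ₐ[κ] RatFunc κ := (IsScalarTower.toAlgHom κ (Polynomial κ) (RatFunc κ)).comp ψ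
  have hψ' : Function.Injective ψ' := hinj.comp hψ
  let Ψ : FractionRing A →ₐ[κ] RatFunc κ := IsFractionRing.liftAlgHom hψ'
  have hΨ : ∀ a : A, Ψ (algebraMap A (FractionRing A) a) = algebraMap _ _ (ψ a) := fun a =>
    IsFractionRing.lift_algebraMap hψ' a
  let Φ : FractionRing A →ₐ[κ] Ω := IsFractionRing.liftAlgHom (g := A.val) Subtype.val_injective
  have hΦ : ∀ a : A, Φ (algebraMap A (FractionRing A) a) = a := fun a =>
    IsFractionRing.lift_algebraMap (g := A.val.toRingHom) Subtype.val_injective a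
  obtain ⟨a, ha⟩ := hdeg
  obtain ⟨q, ⟨γ, hγ⟩, hq⟩ := exists_polynomial_generator (E := Ψ.fieldRange) ha ⟨_, hΨ a⟩
  change Ψ γ = _ at hγ
  refine ⟨Φ γ, fun b hb => ?_, ?_⟩
  · obtain ⟨s, hs⟩ := hq (ψ ⟨b, hb⟩) ⟨_, hΨ ⟨b, hb⟩⟩
    have h1 : algebraMap A (FractionRing A) ⟨b, hb⟩ = Polynomial.aeval γ s := by
      apply Ψ.toRingHom.injective
      change Ψ _ = Ψ _
      rw [hΨ, ← Polynomial.aeval_algHom_apply, hγ, Polynomial.aeval_algebraMap_apply, hs]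
      rfl
    have h2 := congrArg Φ h1
    rw [hΦ, ← Polynomial.aeval_algHom_apply] at h2
    change b = _ at h2
    rw [h2]
    exact Polynomial.aeval_mem_adjoin_singleton κ _
  · obtain ⟨u, w, hw, rfl⟩ := IsFractionRing.div_surjective (A := A) γ
    have hw0 : (w : Ω) ≠ 0 := by simpa using nonZeroDivisors.ne_zero hw
    refine ⟨w, w.2, hw0, ?_⟩
    rw [map_div₀, hΦ, hΦ, mul_div_cancel₀ _ hw0]
    exact u.2

theorem isIntegral_of_le_adjoin_singleton {A : Subalgebra κ Ω} {g : Ω}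
    (hA : A ≤ Algebra.adjoin κ {g}) (hA' : ∃ a ∈ A, a ∉ Set.range (algebraMap κ Ω)) :
    IsIntegral A g := by
  obtain ⟨a, ha, haκ⟩ := hA'
  obtain ⟨p, hp⟩ := Algebra.adjoin_singleton_eq_range_aeval κ g ▸ hA ha
  change Polynomial.aeval g p = a at hp
  have hdeg : p.natDegree ≠ 0 := by
    intro h0
    obtain ⟨c, rfl⟩ := Polynomial.natDegree_eq_zero.1 h0
    exact haκ ⟨c, by rw [← hp, Polynomial.aeval_C]⟩
  have hp0 : p.leadingCoeff⁻¹ ≠ 0 := by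
    rw [Ne, inv_eq_zero, Polynomial.leadingCoeff_eq_zero]
    rintro rfl
    exact hdeg Polynomial.natDegree_zero
  refine IsIntegral.of_aeval_monic
    (p := (Polynomial.C p.leadingCoeff⁻¹ * p).map (algebraMap κ A))
    ((Polynomial.monic_C_mul_of_mul_leadingCoeff_eq_one
      (inv_mul_cancel₀ (mt inv_eq_zero.2 hp0))).map _) ?_ ?_
  · rwa [Polynomial.natDegree_map, Polynomial.natDegree_C_mul hp0]
  · rw [Polynomial.aeval_map_algebraMap, map_mul, Polynomial.aeval_C, hp]
    exact isIntegral_algebraMap (R := A) (A := Ω) (x := algebraMap κ A p.leadingCoeff⁻¹ * ⟨a, ha⟩)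

theorem mem_range_algebraMap_of_isAlgebraic [IsAlgClosed κ] {z : Ω} (hz : IsAlgebraic κ z) :
    z ∈ Set.range (algebraMap κ Ω) := by
  have : Algebra.IsAlgebraic κ (IntermediateField.adjoin κ {z}) :=
    IntermediateField.isAlgebraic_adjoin_simple hz.isIntegral
  have h := IntermediateField.mem_adjoin_simple_self κ z
  rw [IntermediateField.eq_bot_of_isAlgClosed_of_isAlgebraic (IntermediateField.adjoin κ {z})] at h
  exact IntermediateField.mem_bot.1 h

theorem transcendental_of_le_adjoin_singleton [IsAlgClosed κ] {A : Subalgebra κ Ω} {g : Ω}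
    (hA : A ≤ Algebra.adjoin κ {g}) (hA' : ∃ a ∈ A, a ∉ Set.range (algebraMap κ Ω)) :
    Transcendental κ g := by
  intro hg
  obtain ⟨c, hc⟩ := mem_range_algebraMap_of_isAlgebraic hg
  obtain ⟨a, ha, haκ⟩ := hA'
  have : Algebra.adjoin κ {g} ≤ ⊥ := by
    rw [Algebra.adjoin_le_iff, Set.singleton_subset_iff, ← hc]
    exact Subalgebra.algebraMap_mem _ c
  exact haκ (Algebra.mem_bot.1 (this (hA ha)))

theorem isPrincipalIdealRing_adjoin_singleton (g : Ω) :
    IsPrincipalIdealRing (Algebra.adjoin κ {g}) := by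
  rw [Algebra.adjoin_singleton_eq_range_aeval]
  exact IsPrincipalIdealRing.of_surjective (Polynomial.aeval g).rangeRestrict
    (Polynomial.aeval g).rangeRestrict_surjective

end Generator

section Normalization

variable {ι : Type*} {κ : Type*} [Field κ] {Ω : Type*} [Field Ω] [Algebra κ Ω]

theorem isIntegral_of_subring_le {A S : Subring Ω} (h : A ≤ S) {z : Ω} (hz : IsIntegral A z) :
    IsIntegral S z := by
  obtain ⟨p, hp, hpz⟩ := hz
  refine ⟨p.map (Subring.inclusion h), hp.map _, ?_⟩
  rw [Polynomial.eval₂_map]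
  exact hpz

theorem mem_of_isIntegral_of_mul_mem {S : Subring Ω} [IsIntegrallyClosed S] {z w : Ω}
    (hz : IsIntegral S z) (hw : w ∈ S) (hw0 : w ≠ 0) (hwz : w * z ∈ S) : z ∈ S := by
  let Φ : FractionRing S →ₐ[S] Ω :=
    IsFractionRing.liftAlgHom (g := Algebra.ofId S Ω) Subtype.val_injective
  have hΦ : ∀ a : S, Φ (algebraMap S (FractionRing S) a) = a := fun a => Φ.commutes a
  have hΦinj : Function.Injective Φ := Φ.toRingHom.injective
  have hz' : Φ (algebraMap S (FractionRing S) ⟨_, hwz⟩ / algebraMap S (FractionRing S) ⟨w, hw⟩) =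
      z := by
    rw [map_div₀, hΦ, hΦ, mul_div_cancel_left₀ _ hw0]
  rw [← hz', isIntegral_algHom_iff Φ hΦinj, IsIntegrallyClosed.isIntegral_iff] at hz
  obtain ⟨s, hs⟩ := hz
  rw [← hz', ← hs, hΦ]
  exact s.2

theorem isIntegrallyClosed_mvPolynomial (ι D : Type*) [CommRing D] [IsDomain D]
    [IsPrincipalIdealRing D] : IsIntegrallyClosed (MvPolynomial ι D) :=
  inferInstance

theorem isIntegrallyClosed_polyRing {Q : Subring Ω} {y : ι → Ω} (hy : IndepOver Q y) {h : Ω}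
    (hQ : (Algebra.adjoin κ {h}).toSubring ≤ Q) :
    IsIntegrallyClosed (polyRing y (Algebra.adjoin κ {h}).toSubring) := by
  have := isPrincipalIdealRing_adjoin_singleton (κ := κ) h
  have := isIntegrallyClosed_mvPolynomial ι (Algebra.adjoin κ {h})
  let φ : MvPolynomial ι (Algebra.adjoin κ {h}) →+*
      polyRing y (Algebra.adjoin κ {h}).toSubring :=
    (MvPolynomial.aeval y : _ →ₐ[Algebra.adjoin κ {h}] Ω).toRingHom.codRestrict _ fun p => by
      refine mem_polyRing.2 ⟨MvPolynomial.map (algebraMap _ Ω) p, mem_coeffRing.2 fun m => ?_,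
        MvPolynomial.eval_map _ _ _⟩
      rw [MvPolynomial.coeff_map]
      exact (p.coeff m).2
  refine IsIntegrallyClosed.of_equiv (RingEquiv.ofBijective φ ⟨fun p q hpq => ?_, fun r => ?_⟩)
  · exact aeval_injective_of_indepOver hy hQ (congrArg Subtype.val hpq)
  · obtain ⟨p, hp⟩ := exists_aeval_of_mem_polyRing r.2
    exact ⟨p, Subtype.val_injective hp⟩

/-- Two subrings `P` and `Q`, with independent families `x` over `P` and `y` over `Q`, which both
have transcendence degree at most one over `κ` and share only the constants. -/
structure Transverse (κ : Type*) [Field κ] [Algebra κ Ω] (P Q : Subring Ω) (x y : ι → Ω) :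
    Prop where
  indep_left : IndepOver P x
  indep_right : IndepOver Q y
  mem_range : ∀ z ∈ P, z ∈ Q → z ∈ Set.range (algebraMap κ Ω)
  dependent_left : ∀ w ∈ P, ∀ z ∈ P, DependentPair κ w z
  dependent_right : ∀ w ∈ Q, ∀ z ∈ Q, DependentPair κ w z
  algebraMap_mem_left : ∀ c, algebraMap κ Ω c ∈ P
  algebraMap_mem_right : ∀ c, algebraMap κ Ω c ∈ Q
  inv_mem_left : ∀ z ∈ P, z⁻¹ ∈ P
  inv_mem_right : ∀ z ∈ Q, z⁻¹ ∈ Q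

theorem Transverse.symm {P Q : Subring Ω} {x y : ι → Ω} (h : Transverse κ P Q x y) :
    Transverse κ Q P y x :=
  ⟨h.2, h.1, fun z hz hz' => h.3 z hz' hz, h.5, h.4, h.7, h.6, h.9, h.8⟩

variable {P Q : Subring Ω} {x y : ι → Ω}

theorem Transverse.exists_generator [IsAlgClosed κ] (H : Transverse κ P Q x y)
    {A B : Subalgebra κ Ω}
    (hAP : A.toSubring ≤ P) (hBQ : B.toSubring ≤ Q)
    (hR : polyRing x A.toSubring = polyRing y B.toSubring)
    (hA : ∃ a ∈ A, a ∉ Set.range (algebraMap κ Ω)) (hB : ∃ b ∈ B, b ∉ Set.range (algebraMap κ Ω)) :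
    ∃ g : Ω, Transcendental κ g ∧ (Algebra.adjoin κ {g}).toSubring ≤ P ∧
      A ≤ Algebra.adjoin κ {g} ∧ IsIntegral A g ∧ ∃ w ∈ A, w ≠ 0 ∧ w * g ∈ A := by
  obtain ⟨ψ, hψ, hdeg⟩ := exists_injective_algHom_polynomial H.indep_left H.indep_right
    H.mem_range H.dependent_left H.dependent_right hAP hBQ hR hA hB
  obtain ⟨g, hg, w, hw, hw0, hwg⟩ := exists_le_adjoin_singleton ψ hψ hdeg
  refine ⟨g, transcendental_of_le_adjoin_singleton hg hA, ?_, hg,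
    isIntegral_of_le_adjoin_singleton hg hA, w, hw, hw0, hwg⟩
  let P' : Subalgebra κ Ω := { P with algebraMap_mem' := H.algebraMap_mem_left }
  have hgP : g ∈ P' := by
    have h1 : w⁻¹ * (w * g) ∈ P := P.mul_mem (H.inv_mem_left w (hAP hw)) (hAP hwg)
    rwa [inv_mul_cancel_left₀ hw0] at h1
  exact Algebra.adjoin_le (S := P') (Set.singleton_subset_iff.2 hgP)

theorem polyRing_adjoin_le {A B : Subalgebra κ Ω} (hy : IndepOver Q y) {g h : Ω}
    (hQ : (Algebra.adjoin κ {h}).toSubring ≤ Q)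
    (hR : polyRing x A.toSubring = polyRing y B.toSubring) (hBh : B ≤ Algebra.adjoin κ {h})
    (hg : IsIntegral A g) {w : Ω} (hw : w ∈ A) (hw0 : w ≠ 0) (hwg : w * g ∈ A) :
    polyRing x (Algebra.adjoin κ {g}).toSubring ≤ polyRing y (Algebra.adjoin κ {h}).toSubring := by
  have hle : polyRing x A.toSubring ≤ polyRing y (Algebra.adjoin κ {h}).toSubring :=
    hR ▸ polyRing_mono y hBh
  have hAle := (le_polyRing x A.toSubring).trans hle
  have := isIntegrallyClosed_polyRing hy hQ
  have hg' : g ∈ polyRing y (Algebra.adjoin κ {h}).toSubring :=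
    mem_of_isIntegral_of_mul_mem (isIntegral_of_subring_le hAle hg) (hAle hw) hw0 (hAle hwg)
  let S : Subalgebra κ Ω :=
    { polyRing y (Algebra.adjoin κ {h}).toSubring with
      algebraMap_mem' := fun c => le_polyRing y _ (Subalgebra.algebraMap_mem _ c) }
  exact polyRing_le (Algebra.adjoin_le (S := S) (Set.singleton_subset_iff.2 hg'))
    fun i => hle (var_mem_polyRing x _ i)

end Normalization

section PolynomialSubrings

open Polynomial

variable {κ : Type*} [Field κ] {D : Subring κ[X]}

/-- A step of the Euclidean algorithm inside `D`. -/
theorem exists_sub_mul_mem (hD : ∀ p ∈ D, ∀ q ∈ D, q ≠ 0 → p.natDegree = q.natDegree →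
    C (p.leadingCoeff / q.leadingCoeff) ∈ D) {p q : κ[X]} (hp : p ∈ D) (hq : q ∈ D) (hp0 : p ≠ 0)
    (hq0 : q ≠ 0) (hpq : p.natDegree = q.natDegree) :
    ∃ c, C c ∈ D ∧ p - C c * q ∈ D ∧ (p - C c * q).degree < p.degree := by
  have hc := hD p hp q hq hq0 hpq
  have hl : p.leadingCoeff / q.leadingCoeff ≠ 0 :=
    div_ne_zero (leadingCoeff_ne_zero.2 hp0) (leadingCoeff_ne_zero.2 hq0)
  refine ⟨_, hc, D.sub_mem hp (D.mul_mem hc hq), degree_sub_lt_left ?_ hp0 ?_⟩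
  · rw [degree_C_mul hl, degree_eq_natDegree hp0, degree_eq_natDegree hq0, hpq]
  · rw [leadingCoeff_mul, leadingCoeff_C, div_mul_cancel₀ _ (leadingCoeff_ne_zero.2 hq0)]

theorem exists_mem_natDegree_eq_one (hD : ∀ p ∈ D, ∀ q ∈ D, q ≠ 0 → p.natDegree = q.natDegree →
    C (p.leadingCoeff / q.leadingCoeff) ∈ D) (hX : X ∈ D ⊔ (C : κ →+* κ[X]).range) :
    ∃ e ∈ D, e.natDegree = 1 := by
  classical
  obtain ⟨e, he⟩ : ∃ e : ℕ → κ[X], ∀ m, e m ∈ D ∧ (e m ≠ 0 → (e m).natDegree = m) ∧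
      ((∃ p ∈ D, p ≠ 0 ∧ p.natDegree = m) → e m ≠ 0) := by
    have : ∀ m, ∃ p : κ[X], p ∈ D ∧ (p ≠ 0 → p.natDegree = m) ∧
        ((∃ p ∈ D, p ≠ 0 ∧ p.natDegree = m) → p ≠ 0) := by
      intro m
      by_cases h : ∃ p ∈ D, p ≠ 0 ∧ p.natDegree = m
      · obtain ⟨p, hp, hp0, hm⟩ := h
        exact ⟨p, hp, fun _ => hm, fun _ => hp0⟩
      · exact ⟨0, D.zero_mem, fun h0 => (h0 rfl).elim, fun h' => (h h').elim⟩
    choose e he using this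
    exact ⟨e, he⟩
  have hspan : ∀ n : ℕ, ∀ p ∈ D, p.degree < n → p ∈ Submodule.span κ (Set.range e) := by
    intro n
    induction n with
    | zero =>
      intro p _ hpn
      have : p = 0 := by simpa [Polynomial.degree_lt_iff_coeff_zero, Polynomial.ext_iff] using hpn
      rw [this]
      exact Submodule.zero_mem _
    | succ n ih =>
      intro p hp hpn
      rcases eq_or_ne p 0 with rfl | hp0
      · exact Submodule.zero_mem _
      have he0 := (he p.natDegree).2.2 ⟨p, hp, hp0, rfl⟩
      obtain ⟨c, -, hsub, hdeg⟩ := exists_sub_mul_mem hD hp (he p.natDegree).1 hp0 he0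
        ((he p.natDegree).2.1 he0).symm
      have h1 := ih _ hsub (lt_of_lt_of_le hdeg (Order.le_of_lt_succ (by exact_mod_cast hpn)))
      have h2 := Submodule.add_mem _ h1 (Submodule.smul_mem _ c
        (Submodule.subset_span (Set.mem_range_self (f := e) p.natDegree)))
      rwa [smul_eq_C_mul, sub_add_cancel] at h2
  have hXspan : (X : κ[X]) ∈ Submodule.span κ (Set.range e) := by
    have h1 : X ∈ Algebra.adjoin κ (D : Set κ[X]) := by
      have : D ⊔ (C : κ →+* κ[X]).range ≤ (Algebra.adjoin κ (D : Set κ[X])).toSubring := by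
        refine sup_le (fun p hp => Algebra.subset_adjoin hp) ?_
        rintro _ ⟨c, rfl⟩
        exact Subalgebra.algebraMap_mem _ c
      exact this hX
    rw [← Subalgebra.mem_toSubmodule, Algebra.adjoin_eq_span] at h1
    refine Submodule.span_le.2 ?_ h1
    intro p hp
    have hp' : p ∈ D := Submonoid.closure_le.2
      (show (D : Set κ[X]) ⊆ D.toSubmonoid from fun _ h => h) hp
    exact hspan (p.natDegree + 1) p hp'
      (lt_of_le_of_lt degree_le_natDegree (by exact_mod_cast Nat.lt_succ_self _))
  obtain ⟨c, hc⟩ := (Finsupp.mem_span_range_iff_exists_finsupp).1 hXspan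
  have hdeg := degree_sum_eq_of_disjoint (fun m => c m • e m) c.support (by
    intro i hi j hj hij
    have aux : ∀ i, c i • e i ≠ 0 → (c i • e i).degree = i := by
      intro i h
      have hci : c i ≠ 0 := by rintro h0; simp [h0] at h
      have hei : e i ≠ 0 := by rintro h0; simp [h0] at h
      rw [smul_eq_C_mul, degree_C_mul hci, degree_eq_natDegree hei, (he i).2.1 hei]
    simp only [Set.mem_ofPred_eq, Function.onFun, Function.comp] at *
    rw [aux i hi.2, aux j hj.2]
    exact_mod_cast hij)
  have hsum : (∑ m ∈ c.support, c m • e m) = X := hc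
  rw [hsum, degree_X] at hdeg
  have hne : c.support.Nonempty := by
    by_contra h
    rw [Finset.not_nonempty_iff_eq_empty] at h
    rw [h, Finset.sup_empty] at hdeg
    exact absurd hdeg (by decide)
  obtain ⟨i, -, hi⟩ := Finset.exists_mem_eq_sup _ hne fun m => (c m • e m).degree
  rw [hi] at hdeg
  have hci : c i ≠ 0 := by rintro h0; simp [h0] at hdeg
  refine ⟨e i, (he i).1, natDegree_eq_of_degree_eq_some ?_⟩
  rw [Nat.cast_one, hdeg, smul_eq_C_mul, degree_C_mul hci]

/-- A subring of `κ[X]` with these properties is a polynomial ring over a subfield of `κ`. -/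
theorem exists_ringEquiv_polynomial (hD : ∀ p ∈ D, ∀ q ∈ D, q ≠ 0 → p.natDegree = q.natDegree →
    C (p.leadingCoeff / q.leadingCoeff) ∈ D) (hX : X ∈ D ⊔ (C : κ →+* κ[X]).range) :
    ∃ F : Subfield κ, Nonempty (D ≃+* F[X]) := by
  obtain ⟨e, heD, he⟩ := exists_mem_natDegree_eq_one hD hX
  have he0 : e ≠ 0 := by rintro rfl; simp at he
  let F : Subfield κ :=
    { D.comap C with
      inv_mem' := fun c hc => by
        rcases eq_or_ne c 0 with rfl | hc0
        · rw [inv_zero]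
          exact (D.comap C).zero_mem
        have := hD 1 D.one_mem (C c) hc (C_ne_zero.2 hc0) (by simp)
        rw [leadingCoeff_one, leadingCoeff_C, one_div] at this
        exact this }
  have hF : ∀ c : F, C (c : κ) ∈ D := fun c => c.2
  let φ : F[X] →+* D :=
    ((compRingHom e).comp (mapRingHom F.subtype)).codRestrict D fun q => by
      change (q.map F.subtype).comp e ∈ D
      rw [comp, eval₂_eq_sum_range]
      refine D.sum_mem fun i _ => D.mul_mem ?_ (D.pow_mem heD i)
      rw [coeff_map]
      exact hF _
  have hφ : ∀ q, (φ q : κ[X]) = (q.map F.subtype).comp e := fun q => rfl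
  refine ⟨F, ⟨(RingEquiv.ofBijective φ ⟨?_, ?_⟩).symm⟩⟩
  · rw [injective_iff_map_eq_zero]
    intro q hq
    have h1 : (q.map F.subtype).comp e = 0 := by rw [← hφ, hq]; rfl
    rcases comp_eq_zero_iff.1 h1 with h | h
    · exact (Polynomial.map_eq_zero _).1 h
    · rw [h.2, natDegree_C] at he
      exact absurd he (by decide)
  · have key : ∀ n : ℕ, ∀ p ∈ D, p.degree < n → ∃ q, (φ q : κ[X]) = p := by
      intro n
      induction n with
      | zero =>
        intro p _ hpn
        have : p = 0 := by simpa [Polynomial.degree_lt_iff_coeff_zero, Polynomial.ext_iff] using hpn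
        exact ⟨0, by rw [map_zero, this]; rfl⟩
      | succ n ih =>
        intro p hp hpn
        rcases eq_or_ne p 0 with rfl | hp0
        · exact ⟨0, by rw [map_zero]; rfl⟩
        obtain ⟨c, hc, hsub, hdeg⟩ := exists_sub_mul_mem hD hp (D.pow_mem heD p.natDegree) hp0
          (pow_ne_zero _ he0) (by rw [natDegree_pow, he, mul_one])
        obtain ⟨q, hq⟩ := ih _ hsub
          (lt_of_lt_of_le hdeg (Order.le_of_lt_succ (by exact_mod_cast hpn)))
        refine ⟨q + C ⟨c, hc⟩ * X ^ p.natDegree, ?_⟩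
        rw [map_add, Subring.coe_add, hq, hφ]
        simp
    intro p
    obtain ⟨q, hq⟩ := key (p.1.natDegree + 1) p p.2
      (lt_of_le_of_lt degree_le_natDegree (by exact_mod_cast Nat.lt_succ_self _))
    exact ⟨q, Subtype.val_injective hq⟩

end PolynomialSubrings

section Core

variable {ι : Type*} {κ : Type*} [Field κ] {Ω : Type*} [Field Ω] [Algebra κ Ω]

theorem sup_le_integralClosure {A C : Subring Ω} (hC : ∀ c ∈ C, IsIntegral A c) :
    ∀ z ∈ A ⊔ C, IsIntegral A z :=
  (sup_le (c := (integralClosure A Ω).toSubring)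
    (fun a ha => isIntegral_algebraMap (R := A) (A := Ω) (x := ⟨a, ha⟩)) hC : A ⊔ C ≤ _)

/-- The `κ`-subalgebra generated by a subring. -/
def constantExtension (κ : Type*) [Field κ] [Algebra κ Ω] (A : Subring Ω) : Subalgebra κ Ω :=
  { A ⊔ (algebraMap κ Ω).range with
    algebraMap_mem' := fun c => le_sup_right (a := A) ⟨c, rfl⟩ }

theorem constantExtension_toSubring (A : Subring Ω) :
    (constantExtension κ A).toSubring = A ⊔ (algebraMap κ Ω).range := rfl

variable [IsAlgClosed κ] {P Q : Subring Ω} {x y : ι → Ω}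

theorem Transverse.exists_eq_adjoin (H : Transverse κ P Q x y) {A B : Subalgebra κ Ω}
    (hAP : A.toSubring ≤ P) (hBQ : B.toSubring ≤ Q)
    (hR : polyRing x A.toSubring = polyRing y B.toSubring)
    (hA : ∃ a ∈ A, a ∉ Set.range (algebraMap κ Ω)) (hB : ∃ b ∈ B, b ∉ Set.range (algebraMap κ Ω)) :
    ∃ g : Ω, Transcendental κ g ∧ A = Algebra.adjoin κ {g} := by
  obtain ⟨g, hg, hgP, hAg, hgA, w, hw, hw0, hwg⟩ := H.exists_generator hAP hBQ hR hA hB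
  obtain ⟨h, hh, hhQ, hBh, hhB, v, hv, hv0, hvh⟩ := H.symm.exists_generator hBQ hAP hR.symm hB hA
  refine ⟨g, hg, le_antisymm hAg ?_⟩
  have hR' : polyRing x (Algebra.adjoin κ {g}).toSubring =
      polyRing y (Algebra.adjoin κ {h}).toSubring :=
    le_antisymm (polyRing_adjoin_le H.indep_right hhQ hR hBh hgA hw hw0 hwg)
      (polyRing_adjoin_le H.indep_left hgP hR.symm hAg hhB hv hv0 hvh)
  have hsup : A.toSubring ⊔ Subring.closure {g} = (Algebra.adjoin κ {g}).toSubring := by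
    apply le_antisymm
    · exact sup_le hAg (Subring.closure_le.2 (Set.singleton_subset_iff.2
        (Algebra.self_mem_adjoin_singleton κ g)))
    · let S : Subalgebra κ Ω :=
        { A.toSubring ⊔ Subring.closure {g} with
          algebraMap_mem' := fun c => le_sup_left (b := Subring.closure {g})
            (A.algebraMap_mem c) }
      exact Algebra.adjoin_le (S := S) (Set.singleton_subset_iff.2
        (le_sup_right (a := A.toSubring) (Subring.subset_closure rfl)))
  obtain ⟨w', hw', hw'0⟩ := exists_mem_conductor_of_isIntegral (A := A.toSubring) hgA hw hw0 hwg
  rw [hsup] at hw'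
  have hP1 : IsPrincipalIdealRing (Algebra.adjoin κ {g}).toSubring :=
    isPrincipalIdealRing_adjoin_singleton (κ := κ) g
  have hP2 : IsPrincipalIdealRing (Algebra.adjoin κ {h}).toSubring :=
    isPrincipalIdealRing_adjoin_singleton (κ := κ) h
  refine le_of_conductor_ne_zero (A := A.toSubring) H.indep_left H.indep_right hgP hhQ hAg le_rfl
    hBh le_rfl hR hR' hR' ?_ ?_ hw' hw'0
  · rw [← hsup]
    refine sup_le_integralClosure fun c hc => ?_
    have : Subring.closure {g} ≤ (integralClosure A Ω).toSubring :=
      Subring.closure_le.2 (Set.singleton_subset_iff.2 hgA)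
    exact this hc
  · intro z hzP hzQ
    obtain ⟨c, rfl⟩ := H.mem_range z hzP hzQ
    rw [← map_inv₀]
    exact Subalgebra.algebraMap_mem _ _

end Core

section Main

open Polynomial

variable {ι : Type*} {κ : Type*} [Field κ] {Ω : Type*} [Field Ω] [Algebra κ Ω]

/-- Each degree has a form `η` such that `s(t)` has a coefficient `lc(s) * η`. -/
theorem exists_coeff_aeval {T : MvPolynomial ι Ω} (hT : T.totalDegree ≠ 0) (n : ℕ) :
    ∃ s, (T ^ n).coeff s ≠ 0 ∧ ∀ p : κ[X], p.natDegree = n →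
      (aeval T p).coeff s = algebraMap κ Ω p.leadingCoeff * (T ^ n).coeff s := by
  have hT0 : T ≠ 0 := by
    rintro rfl
    exact hT MvPolynomial.totalDegree_zero
  have hdeg : ∀ i, (T ^ i).totalDegree = i * T.totalDegree := by
    intro i
    induction i with
    | zero => simp
    | succ i ih =>
      rw [pow_succ, MvPolynomial.totalDegree_mul_of_isDomain (pow_ne_zero i hT0) hT0, ih]
      ring
  obtain ⟨s, hs, hsdeg⟩ : ∃ s ∈ (T ^ n).support, (T ^ n).totalDegree = s.sum fun _ e => e :=
    Finset.exists_mem_eq_sup _ (MvPolynomial.support_nonempty.2 (pow_ne_zero n hT0)) _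
  refine ⟨s, MvPolynomial.mem_support_iff.1 hs, fun p hp => ?_⟩
  rw [aeval_eq_sum_range, hp, Finset.sum_range_succ, MvPolynomial.coeff_add,
    MvPolynomial.coeff_sum, Finset.sum_eq_zero, zero_add, ← hp, leadingCoeff]
  · rw [MvPolynomial.coeff_smul, Algebra.smul_def]
  · intro i hi
    rw [MvPolynomial.coeff_smul, MvPolynomial.coeff_eq_zero_of_totalDegree_lt, smul_zero]
    change _ < s.sum fun _ e => e
    rw [← hsdeg, hdeg, hdeg]
    exact Nat.mul_lt_mul_of_pos_right (Finset.mem_range.1 hi) (Nat.pos_of_ne_zero hT)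

variable [IsAlgClosed κ] {P Q : Subring Ω} {x y : ι → Ω}

theorem Transverse.exists_sup_range_eq_adjoin (H : Transverse κ P Q x y) {A B : Subring Ω}
    (hAP : A ≤ P) (hBQ : B ≤ Q) (hR : polyRing x A = polyRing y B)
    (hA : ∃ a ∈ A, a ∉ Set.range (algebraMap κ Ω)) (hB : ∃ b ∈ B, b ∉ Set.range (algebraMap κ Ω)) :
    ∃ g : Ω, Transcendental κ g ∧
      A ⊔ (algebraMap κ Ω).range = (Algebra.adjoin κ {g}).toSubring := by
  have hPκ : (algebraMap κ Ω).range ≤ P := by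
    rintro _ ⟨c, rfl⟩
    exact H.algebraMap_mem_left c
  have hQκ : (algebraMap κ Ω).range ≤ Q := by
    rintro _ ⟨c, rfl⟩
    exact H.algebraMap_mem_right c
  obtain ⟨a, ha, haκ⟩ := hA
  obtain ⟨b, hb, hbκ⟩ := hB
  obtain ⟨g, hg, hAg⟩ := H.exists_eq_adjoin (A := constantExtension κ A)
    (B := constantExtension κ B) (sup_le hAP hPκ) (sup_le hBQ hQκ)
    (by rw [constantExtension_toSubring, constantExtension_toSubring, polyRing_sup, polyRing_sup,
      hR]) ⟨a, le_sup_left (b := (algebraMap κ Ω).range) ha, haκ⟩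
    ⟨b, le_sup_left (b := (algebraMap κ Ω).range) hb, hbκ⟩
  exact ⟨g, hg, congrArg Subalgebra.toSubring hAg⟩

/-- A constant which carries a non-zero element of `A[x]` into `A[x]` lies in `A`. -/
theorem Transverse.algebraMap_mem_of_mul_mem (H : Transverse κ P Q x y) {A B : Subring Ω}
    (hAP : A ≤ P) (hBQ : B ≤ Q) (hR : polyRing x A = polyRing y B)
    (hAκ : ∀ c : κ, IsIntegral A (algebraMap κ Ω c))
    (hA : ∃ a ∈ A, a ∉ Set.range (algebraMap κ Ω)) (hB : ∃ b ∈ B, b ∉ Set.range (algebraMap κ Ω))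
    {c : κ} {r : Ω} (hr : r ∈ polyRing x A) (hr0 : r ≠ 0)
    (hcr : algebraMap κ Ω c * r ∈ polyRing x A) : algebraMap κ Ω c ∈ A := by
  obtain ⟨g, -, hg⟩ := H.exists_sup_range_eq_adjoin hAP hBQ hR hA hB
  obtain ⟨h, -, hh⟩ := H.symm.exists_sup_range_eq_adjoin hBQ hAP hR.symm hB hA
  obtain ⟨p, hp, rfl⟩ := mem_polyRing.1 hr
  obtain ⟨m, hm⟩ : ∃ m, p.coeff m ≠ 0 := by
    by_contra! hcon
    exact hr0 (by rw [MvPolynomial.ext p 0 hcon, map_zero])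
  have hcm : p.coeff m * algebraMap κ Ω c ∈ A := by
    have := H.indep_left.coeff_mem hAP (p := MvPolynomial.C (algebraMap κ Ω c) * p)
      (Subring.mul_mem _ (C_mem_coeffRing (H.algebraMap_mem_left c)) (coeffRing_mono hAP hp))
      (by simpa using hcr) m
    rwa [MvPolynomial.coeff_C_mul, mul_comm] at this
  obtain ⟨w, hw, hw0⟩ := exists_mem_conductor_of_isIntegral (hAκ c) (mem_coeffRing.1 hp m) hm hcm
  have hP1 : IsPrincipalIdealRing (Algebra.adjoin κ {g}).toSubring :=
    isPrincipalIdealRing_adjoin_singleton (κ := κ) g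
  have hP2 : IsPrincipalIdealRing (Algebra.adjoin κ {h}).toSubring :=
    isPrincipalIdealRing_adjoin_singleton (κ := κ) h
  rw [← hg] at hP1
  rw [← hh] at hP2
  have hcκ : Subring.closure {algebraMap κ Ω c} ≤ (algebraMap κ Ω).range :=
    Subring.closure_le.2 (Set.singleton_subset_iff.2 ⟨c, rfl⟩)
  have key : A ⊔ Subring.closure {algebraMap κ Ω c} ≤ A := by
    refine le_of_conductor_ne_zero (A' := A ⊔ (algebraMap κ Ω).range)
      (B := B) (B₁ := B ⊔ Subring.closure {algebraMap κ Ω c}) (B' := B ⊔ (algebraMap κ Ω).range)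
      H.indep_left H.indep_right (sup_le hAP ?_)
      (sup_le hBQ ?_) le_sup_left (sup_le_sup_left hcκ A) le_sup_left (sup_le_sup_left hcκ B) hR
      (by rw [polyRing_sup, polyRing_sup, hR]) (by rw [polyRing_sup, polyRing_sup, hR]) ?_ ?_ hw hw0
    · rintro _ ⟨c, rfl⟩
      exact H.algebraMap_mem_left c
    · rintro _ ⟨c, rfl⟩
      exact H.algebraMap_mem_right c
    · refine sup_le_integralClosure ?_
      rintro _ ⟨c, rfl⟩
      exact hAκ c
    · intro z hzP hzQ
      obtain ⟨d, rfl⟩ := H.mem_range z hzP hzQ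
      rw [← map_inv₀]
      exact le_sup_right (a := A) (⟨_, rfl⟩ : _ ∈ (algebraMap κ Ω).range)
  exact key (le_sup_right (a := A) (Subring.subset_closure rfl))

/-- The dichotomy of strong invariance: if `A[x] = B[y]` with `A` and `B` in transverse position,
then `A` is a polynomial ring over a field. -/
theorem Transverse.exists_ringEquiv (H : Transverse κ P Q x y) {A B : Subring Ω}
    (hAP : A ≤ P) (hBQ : B ≤ Q) (hR : polyRing x A = polyRing y B)
    (hAκ : ∀ c : κ, IsIntegral A (algebraMap κ Ω c))
    (hA : ∃ a ∈ A, a ∉ Set.range (algebraMap κ Ω))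
    (hB : ∃ b ∈ B, b ∉ Set.range (algebraMap κ Ω)) :
    ∃ F : Subfield κ, Nonempty (A ≃+* F[X]) := by
  obtain ⟨g, hg, hAg⟩ := H.exists_sup_range_eq_adjoin hAP hBQ hR hA hB
  have hginj := transcendental_iff_injective.1 hg
  have hrange : ∀ z, z ∈ A ⊔ (algebraMap κ Ω).range ↔ ∃ p : κ[X], aeval g p = z := by
    intro z
    rw [hAg, Subalgebra.mem_toSubring, Algebra.adjoin_singleton_eq_range_aeval]
    rfl
  let D : Subring κ[X] := A.comap (aeval g : κ[X] →ₐ[κ] Ω).toRingHom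
  have hmemD : ∀ p, p ∈ D ↔ aeval g p ∈ A := fun p => Iff.rfl
  let φ : D →+* A := ((aeval g : κ[X] →ₐ[κ] Ω).toRingHom.comp D.subtype).codRestrict A fun p => p.2
  have hφ : Function.Bijective φ := by
    refine ⟨fun p q hpq => Subtype.val_injective (hginj (congrArg Subtype.val hpq)), fun a => ?_⟩
    obtain ⟨p, hp⟩ := (hrange a).1 (le_sup_left (b := (algebraMap κ Ω).range) a.2)
    exact ⟨⟨p, (hmemD p).2 (hp ▸ a.2)⟩, Subtype.val_injective hp⟩
  suffices h : ∃ F : Subfield κ, Nonempty (D ≃+* F[X]) by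
    obtain ⟨F, ⟨ψ⟩⟩ := h
    exact ⟨F, ⟨(RingEquiv.ofBijective φ hφ).symm.trans ψ⟩⟩
  refine exists_ringEquiv_polynomial ?_ ?_
  · have hgR : g ∈ polyRing y (B ⊔ (algebraMap κ Ω).range) := by
      rw [polyRing_sup, ← hR, ← polyRing_sup]
      exact le_polyRing x _ ((hrange g).2 ⟨X, aeval_X g⟩)
    obtain ⟨T, hTB, hTg⟩ := mem_polyRing.1 hgR
    have hκQ : (algebraMap κ Ω).range ≤ Q := by
      rintro _ ⟨c, rfl⟩
      exact H.algebraMap_mem_right c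
    have hκP : (algebraMap κ Ω).range ≤ P := by
      rintro _ ⟨c, rfl⟩
      exact H.algebraMap_mem_left c
    have hTQ : T ∈ coeffRing ι Q := coeffRing_mono (sup_le hBQ hκQ) hTB
    have hT : T.totalDegree ≠ 0 := by
      intro h0
      rw [MvPolynomial.totalDegree_eq_zero_iff_eq_C] at h0
      have h1 : T.coeff 0 = g := by
        rw [h0, MvPolynomial.eval_C] at hTg
        exact hTg
      obtain ⟨c, hc⟩ := H.mem_range g (sup_le hAP hκP ((hrange g).2 ⟨X, aeval_X g⟩))
        (h1 ▸ mem_coeffRing.1 hTQ 0)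
      exact hg (hc ▸ isAlgebraic_algebraMap c)
    have haeval : ∀ p : κ[X], aeval T p ∈ coeffRing ι Q := by
      intro p
      rw [aeval_eq_sum_range]
      refine Subring.sum_mem _ fun i _ => ?_
      rw [← IsScalarTower.algebraMap_smul Ω, MvPolynomial.smul_eq_C_mul]
      exact Subring.mul_mem _ (C_mem_coeffRing (H.algebraMap_mem_right _)) (Subring.pow_mem _ hTQ _)
    have heval : ∀ p : κ[X], MvPolynomial.eval y (aeval T p) = aeval g p := by
      intro p
      rw [← hTg, ← MvPolynomial.coe_aeval_eq_eval]
      exact (aeval_algHom_apply ((MvPolynomial.aeval y).restrictScalars κ) T p).symm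
    intro p hp q hq hq0 hpq
    obtain ⟨s, hs, hcoeff⟩ := exists_coeff_aeval (κ := κ) hT q.natDegree
    have hmem : ∀ p ∈ D, p.natDegree = q.natDegree →
        algebraMap κ Ω p.leadingCoeff * (T ^ q.natDegree).coeff s ∈ polyRing x A := by
      intro p hp hpq
      rw [← hcoeff p hpq, hR]
      refine le_polyRing y B (H.indep_right.coeff_mem hBQ (haeval p) ?_ s)
      rw [heval, ← hR]
      exact le_polyRing x A hp
    rw [hmemD, aeval_C]
    have hq0' : algebraMap κ Ω q.leadingCoeff ≠ 0 := by simpa using hq0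
    refine H.algebraMap_mem_of_mul_mem hAP hBQ hR hAκ hA hB (hmem q hq rfl)
      (mul_ne_zero hq0' hs) ?_
    rw [← mul_assoc, map_div₀, div_mul_cancel₀ _ hq0']
    exact hmem p hp hpq
  · have hle : (aeval g : κ[X] →ₐ[κ] Ω).toRingHom.range ≤
        (D ⊔ (C : κ →+* κ[X]).range).map (aeval g : κ[X] →ₐ[κ] Ω).toRingHom := by
      rintro z hz
      have h1 : A ⊔ (algebraMap κ Ω).range ≤
          (D ⊔ (C : κ →+* κ[X]).range).map (aeval g : κ[X] →ₐ[κ] Ω).toRingHom := by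
        refine sup_le (fun a ha => ?_) ?_
        · obtain ⟨p, hp⟩ := hφ.2 ⟨a, ha⟩
          exact ⟨p, le_sup_left (a := D) p.2, congrArg Subtype.val hp⟩
        · rintro _ ⟨c, rfl⟩
          exact ⟨C c, le_sup_right (a := D) ⟨c, rfl⟩, aeval_C g c⟩
      exact h1 ((hrange z).2 hz)
    obtain ⟨p, hp, hpX⟩ := hle ⟨X, rfl⟩
    rwa [hginj hpX] at hp

end Main

section TranscendenceDegreeOne

open Polynomial

theorem dependentPair_of_isTranscendenceBasis {k D : Type*} [Field k] [CommRing D] [IsDomain D]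
    [Algebra k D] {t : D} (ht : IsTranscendenceBasis k (fun _ : Fin 1 => t)) (w z : D) :
    DependentPair k w z := by
  by_cases hw : Transcendental k w
  · have hi : AlgebraicIndependent k (fun _ : Fin 1 => w) :=
      (algebraicIndependent_unique_type_iff (ι := Fin 1)).2 hw
    have hb : IsTranscendenceBasis k (fun _ : Fin 1 => w) :=
      hi.isTranscendenceBasis_of_lift_trdeg_le_of_finite ht.lift_cardinalMk_eq_trdeg.symm.le
    have halg := hb.isAlgebraic
    rw [Set.range_const] at halg
    obtain ⟨f, hf, hfz⟩ := halg.isAlgebraic z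
    refine ⟨(Polynomial.Bivariate.Transcendental.algEquivAdjoin hw).symm f, by simpa using hf, ?_⟩
    obtain ⟨q, rfl⟩ := (Polynomial.Bivariate.Transcendental.algEquivAdjoin hw).surjective f
    rw [AlgEquiv.symm_apply_apply, ← hfz,
      Polynomial.Bivariate.Transcendental.algEquivAdjoin_apply, Polynomial.coe_mapAlgHom,
      aeval_def, Polynomial.eval₂_map]
    congr 1
    exact Polynomial.ringHom_ext (fun a => by simp [← IsScalarTower.algebraMap_apply]) (by simp)
  · obtain ⟨p, hp, hpw⟩ := not_not.1 hw
    exact ⟨C p, by simpa using hp, by simpa using hpw⟩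

theorem DependentPair.map {k κ D E : Type*} [Field k] [Field κ] [CommRing D] [CommRing E]
    [Algebra k D] [Algebra k κ] [Algebra k E] [Algebra κ E] [IsScalarTower k κ E]
    (f : D →ₐ[k] E) {w z : D} (h : DependentPair k w z) : DependentPair κ (f w) (f z) := by
  obtain ⟨q, hq, hqz⟩ := h
  refine ⟨q.map (mapRingHom (algebraMap k κ)), ?_, ?_⟩
  · rwa [Ne, Polynomial.map_eq_zero_iff (Polynomial.map_injective _ (algebraMap k κ).injective)]
  · have := congrArg f.toRingHom hqz
    rw [Polynomial.hom_eval₂, map_zero] at this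
    rw [Polynomial.eval₂_map, ← this]
    congr 1
    refine Polynomial.ringHom_ext (fun a => ?_) (by simp)
    simp [← IsScalarTower.algebraMap_apply]

/-- A non-trivial relation makes the second element algebraic over any ring containing the first,
provided the first is transcendental. -/
theorem DependentPair.isAlgebraic {κ Ω : Type*} [Field κ] [Field Ω] [Algebra κ Ω]
    {Q : Subalgebra κ Ω} {w z : Ω} (hw : Transcendental κ w) (hwQ : w ∈ Q)
    (h : DependentPair κ w z) : IsAlgebraic Q z := by
  obtain ⟨q, hq, hqz⟩ := h
  have hw' : Transcendental κ (⟨w, hwQ⟩ : Q) := fun h => hw (h.algHom Q.val)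
  refine ⟨q.map (aeval (⟨w, hwQ⟩ : Q) : κ[X] →ₐ[κ] Q).toRingHom, ?_, ?_⟩
  · rwa [Ne, Polynomial.map_eq_zero_iff]
    exact transcendental_iff_injective.1 hw'
  · rw [aeval_def, Polynomial.eval₂_map, ← hqz]
    congr 1
    exact Polynomial.ringHom_ext (fun a => by simp [← IsScalarTower.algebraMap_apply]) (by simp)

end TranscendenceDegreeOne

section Closures

variable {k Ω ι : Type*} [Field k] [Field Ω] [Algebra k Ω]

/-- The elements of `Ω` which are algebraic over `A`. -/
noncomputable def algClosureIn (A : Subalgebra k Ω) : Subring Ω :=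
  (Subalgebra.algebraicClosure A Ω).toSubring

theorem le_algClosureIn (A : Subalgebra k Ω) : A.toSubring ≤ algClosureIn A :=
  fun a ha => isAlgebraic_algebraMap (⟨a, ha⟩ : A)

theorem indepOver_algClosureIn {A : Subalgebra k Ω} {x : ι → Ω} (hx : AlgebraicIndependent A x) :
    IndepOver (algClosureIn A) x := by
  have h : ∀ q : MvPolynomial ι (Subalgebra.algebraicClosure A Ω),
      MvPolynomial.eval₂ (algebraMap (Subalgebra.algebraicClosure A Ω) Ω) x q = 0 → q = 0 :=
    fun q hq => hx.subalgebraAlgebraicClosure (by rw [map_zero, MvPolynomial.aeval_def, hq])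
  rintro _ ⟨q, rfl⟩ hq
  rw [MvPolynomial.eval_map] at hq
  exact (congrArg _ (h q hq)).trans (map_zero (MvPolynomial.map (algClosureIn A).subtype))

theorem dependentPair_of_mem_algClosureIn {κ : Type*} [Field κ] [Algebra k κ] [Algebra κ Ω]
    [IsScalarTower k κ Ω] {A : Subalgebra k Ω} {t : A}
    (ht : IsTranscendenceBasis k (fun _ : Fin 1 => t)) {w z : Ω} (hw : w ∈ algClosureIn A)
    (hz : z ∈ algClosureIn A) : DependentPair κ w z := by
  have : FaithfulSMul A (Subalgebra.algebraicClosure A Ω) :=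
    (faithfulSMul_iff_algebraMap_injective _ _).2 fun a b h =>
      Subtype.ext (congrArg (Subalgebra.algebraicClosure A Ω).val h)
  have hb : IsTranscendenceBasis k
      (fun _ : Fin 1 => algebraMap A (Subalgebra.algebraicClosure A Ω) t) :=
    ht.algebraMap_comp
  exact (dependentPair_of_isTranscendenceBasis hb ⟨w, hw⟩ ⟨z, hz⟩).map
    ((Subalgebra.algebraicClosure A Ω).val.restrictScalars k)

theorem algClosureIn_le {A B : Subalgebra k Ω} {t : A}
    (ht : IsTranscendenceBasis k (fun _ : Fin 1 => t)) {z : Ω} (hz : Transcendental k z)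
    (hzA : z ∈ algClosureIn A) (hzB : z ∈ algClosureIn B) : algClosureIn A ≤ algClosureIn B := by
  intro w hw
  have h := DependentPair.isAlgebraic
    (Q := (Subalgebra.algebraicClosure B Ω).restrictScalars k) hz hzB
    (dependentPair_of_mem_algClosureIn (κ := k) ht hzA hw)
  have h' : IsAlgebraic (Subalgebra.algebraicClosure B Ω) w := h
  exact h'.restrictScalars B

variable {A B : Subalgebra k Ω} {x y : ι → Ω}

theorem isAlgebraic_coe (c : algebraicClosure k Ω) : IsAlgebraic k (c : Ω) :=
  mem_algebraicClosure_iff.1 c.2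

theorem isIntegral_coe (A : Subalgebra k Ω) (c : algebraicClosure k Ω) :
    IsIntegral A (c : Ω) :=
  (isAlgebraic_iff_isIntegral.1 (isAlgebraic_coe c)).tower_top

theorem exists_transcendental_mem {t : A} (ht : IsTranscendenceBasis k (fun _ : Fin 1 => t)) :
    ∃ a ∈ A.toSubring, a ∉ Set.range (algebraMap (algebraicClosure k Ω) Ω) := by
  refine ⟨t, t.2, ?_⟩
  rintro ⟨c, hc⟩
  have h1 : Transcendental k t := (algebraicIndependent_unique_type_iff (ι := Fin 1)).1 ht.1
  refine h1 ?_
  have h2 : IsAlgebraic k (t : Ω) := hc ▸ isAlgebraic_coe c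
  exact (isAlgebraic_algHom_iff A.val Subtype.val_injective).1 h2

theorem transverse_algClosureIn (hx : AlgebraicIndependent A x) (hy : AlgebraicIndependent B y)
    (hA : ∃ t : A, IsTranscendenceBasis k (fun _ : Fin 1 => t))
    (hB : ∃ t : B, IsTranscendenceBasis k (fun _ : Fin 1 => t))
    (hAB : algClosureIn A ≠ algClosureIn B) :
    Transverse (algebraicClosure k Ω) (algClosureIn A) (algClosureIn B) x y := by
  obtain ⟨s, hs⟩ := hA
  obtain ⟨t, ht⟩ := hB
  refine ⟨indepOver_algClosureIn hx, indepOver_algClosureIn hy, fun z hzA hzB => ?_,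
    fun _ hw _ hz => dependentPair_of_mem_algClosureIn hs hw hz,
    fun _ hw _ hz => dependentPair_of_mem_algClosureIn ht hw hz,
    fun c => (isIntegral_coe A c).isAlgebraic, fun c => (isIntegral_coe B c).isAlgebraic,
    fun _ => IsAlgebraic.inv, fun _ => IsAlgebraic.inv⟩
  by_contra hz
  have hz' : Transcendental k z := fun h => hz ⟨⟨z, mem_algebraicClosure_iff.2 h⟩, rfl⟩
  exact hAB ((algClosureIn_le hs hz' hzA hzB).antisymm (algClosureIn_le ht hz' hzB hzA))

/-- Two subalgebras of transcendence degree one with a common polynomial ring coincide, unless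
they are polynomial rings over fields. -/
theorem eq_or_exists_ringEquiv [IsAlgClosed Ω] (hx : AlgebraicIndependent A x)
    (hy : AlgebraicIndependent B y)
    (hA : ∃ t : A, IsTranscendenceBasis k (fun _ : Fin 1 => t))
    (hB : ∃ t : B, IsTranscendenceBasis k (fun _ : Fin 1 => t))
    (hR : polyRing x A.toSubring = polyRing y B.toSubring) :
    A = B ∨ ∃ F : Subfield (algebraicClosure k Ω), Nonempty (A ≃+* Polynomial F) := by
  by_cases hAB : algClosureIn A = algClosureIn B
  · left
    apply le_antisymm
    · exact fun a ha => (indepOver_algClosureIn hy).mem_of_mem_polyRing (le_algClosureIn B)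
        (hAB ▸ le_algClosureIn A ha) (hR ▸ le_polyRing x A.toSubring ha)
    · exact fun a ha => (indepOver_algClosureIn hx).mem_of_mem_polyRing (le_algClosureIn A)
        (hAB ▸ le_algClosureIn B ha) (hR ▸ le_polyRing y B.toSubring ha)
  · right
    have : IsAlgClosed (algebraicClosure k Ω) := IsAlgClosure.isAlgClosed k
    have H := transverse_algClosureIn hx hy hA hB hAB
    obtain ⟨s, hs⟩ := hA
    obtain ⟨t, ht⟩ := hB
    exact H.exists_ringEquiv (le_algClosureIn A) (le_algClosureIn B) hR
      (isIntegral_coe A) (exists_transcendental_mem hs) (exists_transcendental_mem ht)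

end Closures

section Embeddings

variable {k Ω ι : Type*} [Field k] [Field Ω] [Algebra k Ω]

theorem algebraicIndependent_range {A : Type*} [CommRing A] [Algebra k A]
    (θ : MvPolynomial ι A →ₐ[k] Ω) (hθ : Function.Injective θ) :
    AlgebraicIndependent (θ.comp (IsScalarTower.toAlgHom k A (MvPolynomial ι A))).range
      (fun i => θ (MvPolynomial.X i)) := by
  let φ := (θ.comp (IsScalarTower.toAlgHom k A (MvPolynomial ι A))).rangeRestrict.toRingHom
  have hφ : Function.Surjective φ := AlgHom.rangeRestrict_surjective _
  refine (injective_iff_map_eq_zero _).2 fun p hp => ?_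
  obtain ⟨q, rfl⟩ := MvPolynomial.map_surjective φ hφ p
  have hq : θ q = 0 := by
    rw [← hp, MvPolynomial.aeval_def, MvPolynomial.eval₂_map]
    exact (congrFun (congrArg DFunLike.coe (MvPolynomial.ringHom_ext (f := θ.toRingHom)
      (g := MvPolynomial.eval₂Hom ((algebraMap _ Ω).comp φ) fun i => θ (MvPolynomial.X i))
      (fun a => by rw [MvPolynomial.coe_eval₂Hom, MvPolynomial.eval₂_C]; rfl)
      (fun i => by rw [MvPolynomial.coe_eval₂Hom, MvPolynomial.eval₂_X]; rfl))) q)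
  rw [(map_eq_zero_iff θ hθ).1 hq, map_zero]

theorem exists_isTranscendenceBasis_range {A : Type*} [CommRing A] [Algebra k A] (f : A →ₐ[k] Ω)
    (hf : Function.Injective f) (hA : ∃ t : A, IsTranscendenceBasis k (fun _ : Fin 1 => t)) :
    ∃ t : f.range, IsTranscendenceBasis k (fun _ : Fin 1 => t) := by
  obtain ⟨t, ht⟩ := hA
  exact ⟨_, (AlgEquiv.ofInjective f hf).isTranscendenceBasis ht⟩

theorem polyRing_range {A : Type*} [CommRing A] [Algebra k A]
    (θ : MvPolynomial ι A →ₐ[k] Ω) :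
    polyRing (fun i => θ (MvPolynomial.X i))
      (θ.comp (IsScalarTower.toAlgHom k A (MvPolynomial ι A))).range.toSubring =
      θ.toRingHom.range := by
  apply le_antisymm
  · refine polyRing_le ?_ fun i => ⟨_, rfl⟩
    rintro _ ⟨a, rfl⟩
    exact ⟨_, rfl⟩
  · rintro _ ⟨p, rfl⟩
    induction p using MvPolynomial.induction_on with
    | C a => exact le_polyRing _ _ ⟨a, rfl⟩
    | add p q hp hq => simpa using Subring.add_mem _ hp hq
    | mul_X p i hp => simpa using Subring.mul_mem _ hp (var_mem_polyRing _ _ i)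

end Embeddings

end StrongInvariance

/-- Abhyankar–Eakin–Heinzer strong invariance: Let `A`, `B` be `k`-domains
of transcendence degree 1 with `A^{[n]} = B^{[n]}` (identified via `e`) for some `n ≥ 1`.
If `A` is not isomorphic to a polynomial ring over a field, then `A = B` (the images of
`A` and `B` as coefficient rings coincide). -/
theorem strong_invariance (k : Type u) [Field k]
    (A : Type v) [CommRing A] [IsDomain A] [Algebra k A]
    (B : Type v) [CommRing B] [IsDomain B] [Algebra k B]
    (hA : ∃ x : A, IsTranscendenceBasis k (fun _ : Fin 1 => x))
    (hB : ∃ y : B, IsTranscendenceBasis k (fun _ : Fin 1 => y))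
    (n : ℕ) (hn : 1 ≤ n)
    (e : MvPolynomial (Fin n) A ≃ₐ[k] MvPolynomial (Fin n) B)
    (hnp : ¬ ∃ (F : Type v) (_ : Field F), Nonempty (A ≃+* Polynomial F)) :
    (e.toAlgHom.comp (IsScalarTower.toAlgHom k A (MvPolynomial (Fin n) A))).range =
      (IsScalarTower.toAlgHom k B (MvPolynomial (Fin n) B)).range := by
  let Ω := AlgebraicClosure (FractionRing (MvPolynomial (Fin n) A))
  let θ : MvPolynomial (Fin n) A →ₐ[k] Ω :=
    (IsScalarTower.toAlgHom k (FractionRing (MvPolynomial (Fin n) A)) Ω).comp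
      (IsScalarTower.toAlgHom k _ _)
  let η : MvPolynomial (Fin n) B →ₐ[k] Ω := θ.comp e.symm.toAlgHom
  have hθ : Function.Injective θ :=
    (FaithfulSMul.algebraMap_injective (FractionRing (MvPolynomial (Fin n) A)) Ω).comp
      (IsFractionRing.injective (MvPolynomial (Fin n) A) (FractionRing (MvPolynomial (Fin n) A)))
  have hη : Function.Injective η := hθ.comp e.symm.injective
  have hfA : Function.Injective (θ.comp (IsScalarTower.toAlgHom k A (MvPolynomial (Fin n) A))) :=
    hθ.comp (MvPolynomial.C_injective _ _)
  have hfB : Function.Injective (η.comp (IsScalarTower.toAlgHom k B (MvPolynomial (Fin n) B))) :=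
    hη.comp (MvPolynomial.C_injective _ _)
  have hR : θ.toRingHom.range = η.toRingHom.range := by
    ext z
    constructor
    · rintro ⟨p, rfl⟩
      exact ⟨e p, congrArg θ (e.symm_apply_apply p)⟩
    · rintro ⟨p, rfl⟩
      exact ⟨e.symm p, rfl⟩
  rcases StrongInvariance.eq_or_exists_ringEquiv (StrongInvariance.algebraicIndependent_range θ hθ)
    (StrongInvariance.algebraicIndependent_range η hη)
    (StrongInvariance.exists_isTranscendenceBasis_range _ hfA hA)
    (StrongInvariance.exists_isTranscendenceBasis_range _ hfB hB)
    (by rw [StrongInvariance.polyRing_range, StrongInvariance.polyRing_range, hR]) with h | ⟨F, ⟨f⟩⟩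
  · have hcomp : θ = η.comp e.toAlgHom :=
      AlgHom.ext fun p => congrArg θ (e.symm_apply_apply p).symm
    rw [hcomp, AlgHom.comp_assoc, AlgHom.range_comp _ η, AlgHom.range_comp _ η] at h
    exact Subalgebra.map_injective hη h
  · exact (hnp ⟨F, inferInstance, ⟨(AlgEquiv.ofInjective _ hfA).toRingEquiv.trans f⟩⟩).elim
end

section
/- Let k be an algebraically closed field and φ a nontrivial exponential map on the polynomial ring k[X,Y]. Then the ring of invariants k[X,Y]^φ equals k[f] for some f ∈ k[X,Y] which is a coordinate, i.e., k[X,Y] = k[f][g] for some g ∈ k[X,Y]. -/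
structure ExpMap (k A : Type*) [Field k] [CommRing A] [Algebra k A] where
  toFun : A →ₐ[k] Polynomial A
  eval_zero : ∀ a : A, (toFun a).eval 0 = a
  coaction : ∀ a : A,
    (toFun a).map (toFun.toRingHom) =
      (toFun a).eval₂ (Polynomial.C.comp Polynomial.C)
        (Polynomial.X + Polynomial.C Polynomial.X)

variable {k A : Type*} [Field k] [CommRing A] [Algebra k A]

/-- The ring of invariants `A^φ = {a ∈ A : φ(a) = a}` of an exponential map. -/
def ExpMap.invariants (φ : ExpMap k A) : Subalgebra k A where
  carrier := {a : A | φ.toFun a = Polynomial.C a}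
  mul_mem' := by
    intro a b ha hb
    simp only [Set.mem_setOf_eq, map_mul] at *
    rw [ha, hb]
  add_mem' := by
    intro a b ha hb
    simp only [Set.mem_setOf_eq, map_add] at *
    rw [ha, hb]
  algebraMap_mem' := by
    intro r
    simp only [Set.mem_setOf_eq, AlgHom.commutes, Polynomial.algebraMap_apply]

/-- An exponential map is nontrivial if its ring of invariants is a proper subring. -/
def ExpMap.Nontrivial (φ : ExpMap k A) : Prop := ∃ a : A, φ.toFun a ≠ Polynomial.C a

/-- If `n.choose j` and `m.choose j` vanish in `R` for all `0 < j < n`, then `n ∣ m`. -/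
theorem Nat.dvd_of_choose_cast_eq_zero (R : Type*) [CommRing R] [Nontrivial R]
    {m n : ℕ} (hn0 : 0 < n)
    (hn : ∀ j, 0 < j → j < n → (n.choose j : R) = 0)
    (hm : ∀ j, 0 < j → j < n → (m.choose j : R) = 0) : n ∣ m := by
  by_contra hdvd
  have hr : 0 < m % n := Nat.pos_of_ne_zero fun h => hdvd (Nat.dvd_of_mod_eq_zero h)
  have hrn : m % n < n := Nat.mod_lt _ hn0
  have h1 : ((1 : Polynomial R) + Polynomial.X) ^ n = 1 + Polynomial.X ^ n := by
    ext i
    rw [Polynomial.coeff_one_add_X_pow, Polynomial.coeff_add, Polynomial.coeff_one,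
      Polynomial.coeff_X_pow]
    rcases Nat.eq_zero_or_pos i with rfl | hi
    · simp [hn0.ne]
    · rcases lt_trichotomy i n with h | h | h
      · simp [hn i hi h, hi.ne', h.ne]
      · simp [h, hn0.ne']
      · simp [Nat.choose_eq_zero_of_lt h, hi.ne', h.ne']
  have h2 : Polynomial.X ^ n ∣ ((1 : Polynomial R) + Polynomial.X ^ n) ^ (m / n) - 1 := by
    have h := sub_dvd_pow_sub_pow ((1 : Polynomial R) + Polynomial.X ^ n) 1 (m / n)
    rwa [one_pow, add_sub_cancel_left] at h
  obtain ⟨s, hs⟩ := h2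
  have h3 : ((1 : Polynomial R) + Polynomial.X) ^ m =
      (1 + Polynomial.X) ^ (m % n) + Polynomial.X ^ n * (s * (1 + Polynomial.X) ^ (m % n)) := by
    have h5 : ((1 : Polynomial R) + Polynomial.X) ^ m =
        ((1 + Polynomial.X) ^ n) ^ (m / n) * (1 + Polynomial.X) ^ (m % n) := by
      rw [← pow_mul, ← pow_add, Nat.div_add_mod]
    rw [h5, h1, sub_eq_iff_eq_add.1 hs]
    ring
  have h4 := congrArg (fun p => p.coeff (m % n)) h3
  simp only [Polynomial.coeff_add, Polynomial.coeff_one_add_X_pow, Polynomial.coeff_X_pow_mul',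
    if_neg hrn.not_ge, hm _ hr hrn, Nat.choose_self] at h4
  simp at h4

namespace ExpMap

theorem toFun_coeff_zero (φ : ExpMap k A) (a : A) : (φ.toFun a).coeff 0 = a := by
  rw [Polynomial.coeff_zero_eq_eval_zero, φ.eval_zero]

theorem toFun_injective (φ : ExpMap k A) : Function.Injective φ.toFun := fun a b h => by
  rw [← φ.toFun_coeff_zero a, h, φ.toFun_coeff_zero]

theorem mem_invariants_iff (φ : ExpMap k A) {a : A} :
    a ∈ φ.invariants ↔ φ.toFun a = Polynomial.C a := Iff.rfl

theorem mem_invariants_iff_natDegree (φ : ExpMap k A) {a : A} :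
    a ∈ φ.invariants ↔ (φ.toFun a).natDegree = 0 := by
  rw [mem_invariants_iff]
  refine ⟨fun h => by rw [h, Polynomial.natDegree_C], fun h => ?_⟩
  rw [Polynomial.eq_C_of_natDegree_eq_zero h, φ.toFun_coeff_zero]

theorem toFun_ne_zero (φ : ExpMap k A) {a : A} (ha : a ≠ 0) : φ.toFun a ≠ 0 :=
  (map_ne_zero_iff _ φ.toFun_injective).2 ha

theorem natDegree_toFun_mul [IsDomain A] (φ : ExpMap k A) {a b : A} (ha : a ≠ 0) (hb : b ≠ 0) :
    (φ.toFun (a * b)).natDegree = (φ.toFun a).natDegree + (φ.toFun b).natDegree := by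
  rw [map_mul, Polynomial.natDegree_mul (φ.toFun_ne_zero ha) (φ.toFun_ne_zero hb)]

/-- The ring of invariants is factorially closed. -/
theorem mem_invariants_of_dvd [IsDomain A] (φ : ExpMap k A) {a b : A} (hab : a ∣ b) (hb : b ≠ 0)
    (h : b ∈ φ.invariants) : a ∈ φ.invariants := by
  obtain ⟨c, rfl⟩ := hab
  rw [mem_invariants_iff_natDegree, φ.natDegree_toFun_mul (left_ne_zero_of_mul hb)
    (right_ne_zero_of_mul hb)] at h
  rw [mem_invariants_iff_natDegree]
  omega

theorem coeff_toFun_coeff (φ : ExpMap k A) (a : A) (i j : ℕ) :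
    (φ.toFun ((φ.toFun a).coeff i)).coeff j = (i + j).choose i * (φ.toFun a).coeff (i + j) := by
  have h := congrArg (fun p => (p.coeff i).coeff j) (φ.coaction a)
  simp only [Polynomial.coeff_map] at h
  refine h.trans ?_
  rw [Polynomial.eval₂_eq_sum, Polynomial.sum, Polynomial.finsetSum_coeff,
    Polynomial.finsetSum_coeff]
  have key : ∀ e, ((((Polynomial.C.comp Polynomial.C) ((φ.toFun a).coeff e) *
      (Polynomial.X + Polynomial.C (Polynomial.X : Polynomial A)) ^ e).coeff i).coeff j) =
      if e = i + j then ((i + j).choose i : A) * (φ.toFun a).coeff (i + j) else 0 := by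
    intro e
    rw [RingHom.comp_apply, Polynomial.coeff_C_mul, Polynomial.coeff_C_mul,
      Polynomial.coeff_X_add_C_pow, ← Polynomial.C_eq_natCast, Polynomial.coeff_mul_C,
      Polynomial.coeff_X_pow]
    split_ifs with h1 h2 h2
    · subst h2; ring
    · have : e < i := by omega
      simp [Nat.choose_eq_zero_of_lt this]
    · omega
    · simp
  simp_rw [key]
  rw [Finset.sum_ite_eq']
  split_ifs with h1
  · rfl
  · rw [Polynomial.notMem_support_iff.1 h1, mul_zero]

theorem leadingCoeff_mem_invariants (φ : ExpMap k A) (a : A) :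
    (φ.toFun a).leadingCoeff ∈ φ.invariants := by
  rw [mem_invariants_iff_natDegree, ← Nat.le_zero, Polynomial.natDegree_le_iff_coeff_eq_zero]
  intro j hj
  rw [Polynomial.leadingCoeff, coeff_toFun_coeff,
    Polynomial.coeff_eq_zero_of_natDegree_lt (by omega), mul_zero]

/-- `n` is the smallest positive degree attained by `φ`. -/
def IsMinDegree (φ : ExpMap k A) (n : ℕ) : Prop :=
  IsLeast {m | 0 < m ∧ ∃ a, (φ.toFun a).natDegree = m} n

theorem exists_isMinDegree {φ : ExpMap k A} (hφ : φ.Nontrivial) : ∃ n, φ.IsMinDegree n := by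
  obtain ⟨a, ha⟩ := hφ
  have hne : {m | 0 < m ∧ ∃ a, (φ.toFun a).natDegree = m}.Nonempty :=
    ⟨_, Nat.pos_of_ne_zero fun h => ha (φ.mem_invariants_iff_natDegree.2 h), a, rfl⟩
  exact ⟨_, Nat.sInf_mem hne, fun m hm => Nat.sInf_le hm⟩

theorem IsMinDegree.choose_eq_zero [IsDomain A] {φ : ExpMap k A} {n : ℕ} (hn : φ.IsMinDegree n)
    {a : A} (ha : a ∉ φ.invariants) {j : ℕ} (hj : 0 < j) (hjn : j < n) :
    ((φ.toFun a).natDegree.choose j : A) = 0 := by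
  set m := (φ.toFun a).natDegree with hm
  have ha0 : a ≠ 0 := fun h => ha (h ▸ zero_mem _)
  have hnm : n ≤ m :=
    hn.2 ⟨Nat.pos_of_ne_zero fun h => ha (φ.mem_invariants_iff_natDegree.2 h), a, rfl⟩
  by_contra hne
  have hc : ∀ l, (φ.toFun ((φ.toFun a).coeff (m - j))).coeff l =
      (m - j + l).choose (m - j) * (φ.toFun a).coeff (m - j + l) := φ.coeff_toFun_coeff a (m - j)
  have hdeg : (φ.toFun ((φ.toFun a).coeff (m - j))).natDegree = j := by
    refine Polynomial.natDegree_eq_of_le_of_coeff_ne_zero ?_ ?_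
    · rw [Polynomial.natDegree_le_iff_coeff_eq_zero]
      intro l hl
      rw [hc, Polynomial.coeff_eq_zero_of_natDegree_lt (by omega), mul_zero]
    · rw [hc, Nat.sub_add_cancel (by omega), Nat.choose_symm (by omega)]
      exact mul_ne_zero hne (Polynomial.leadingCoeff_ne_zero.2 (φ.toFun_ne_zero ha0))
  exact absurd (hn.2 ⟨hj, _, hdeg⟩) (by omega)

theorem IsMinDegree.dvd_natDegree [IsDomain A] {φ : ExpMap k A} {n : ℕ} (hn : φ.IsMinDegree n)
    (a : A) : n ∣ (φ.toFun a).natDegree := by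
  by_cases ha : a ∈ φ.invariants
  · rw [φ.mem_invariants_iff_natDegree.1 ha]; exact dvd_zero n
  · obtain ⟨x, hx⟩ := hn.1.2
    have hxi : x ∉ φ.invariants := by
      rw [mem_invariants_iff_natDegree, hx]; exact hn.1.1.ne'
    refine Nat.dvd_of_choose_cast_eq_zero A hn.1.1 (fun j hj hjn => ?_)
      fun j hj hjn => hn.choose_eq_zero ha hj hjn
    rw [← hx]
    exact hn.choose_eq_zero hxi hj hjn

/-- An element of minimal positive degree generates the algebra over the invariants, up to
denominators which are powers of its leading coefficient. -/
theorem IsMinDegree.exists_pow_mul_mem_adjoin [IsDomain A] {φ : ExpMap k A} {n : ℕ}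
    (hn : φ.IsMinDegree n) {x : A} (hx : (φ.toFun x).natDegree = n) (a : A) :
    ∃ N : ℕ, (φ.toFun x).leadingCoeff ^ N * a ∈ Algebra.adjoin φ.invariants {x} := by
  set c := (φ.toFun x).leadingCoeff with hc
  have hinv : ∀ b ∈ φ.invariants, b ∈ Algebra.adjoin φ.invariants {x} := fun b hb =>
    Subalgebra.algebraMap_mem _ (⟨b, hb⟩ : φ.invariants)
  have hcinv : c ∈ φ.invariants := φ.leadingCoeff_mem_invariants x
  have hxm : x ∈ Algebra.adjoin φ.invariants {x} := Algebra.self_mem_adjoin_singleton _ _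
  induction hm : (φ.toFun a).natDegree using Nat.strong_induction_on generalizing a with
  | _ m ih =>
    rcases Nat.eq_zero_or_pos m with rfl | hpos
    · exact ⟨0, by simpa using hinv a (φ.mem_invariants_iff_natDegree.2 hm)⟩
    · obtain ⟨q, hq⟩ := hn.dvd_natDegree a
      set d := (φ.toFun a).leadingCoeff with hd
      have hdinv : d ∈ φ.invariants := φ.leadingCoeff_mem_invariants a
      have hlt : (φ.toFun (c ^ q * a - d * x ^ q)).natDegree < m := by
        have h1 : φ.toFun (c ^ q * a - d * x ^ q) =
            Polynomial.C (c ^ q) * φ.toFun a - Polynomial.C d * φ.toFun x ^ q := by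
          rw [map_sub, map_mul, map_mul, map_pow φ.toFun x, φ.mem_invariants_iff.1 hdinv,
            φ.mem_invariants_iff.1 (pow_mem hcinv q)]
        rw [h1]
        have hxd : (φ.toFun x ^ q).natDegree = m := by
          rw [Polynomial.natDegree_pow, hx, ← hm, hq, mul_comm]
        rw [Nat.lt_iff_le_pred hpos, Polynomial.natDegree_le_iff_coeff_eq_zero]
        intro l hl
        rw [Polynomial.coeff_sub, Polynomial.coeff_C_mul, Polynomial.coeff_C_mul]
        rcases eq_or_lt_of_le (show m ≤ l by omega) with rfl | hl'
        · have e1 : (φ.toFun a).coeff m = d := by rw [hd, Polynomial.leadingCoeff, hm]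
          have e2 : (φ.toFun x ^ q).coeff m = c ^ q := by
            rw [hc, ← Polynomial.leadingCoeff_pow, Polynomial.leadingCoeff, hxd]
          rw [e1, e2]; ring
        · rw [Polynomial.coeff_eq_zero_of_natDegree_lt (by omega),
            Polynomial.coeff_eq_zero_of_natDegree_lt (by omega)]
          ring
      obtain ⟨N, hN⟩ := ih _ hlt _ rfl
      refine ⟨N + q, ?_⟩
      have : c ^ (N + q) * a = c ^ N * (c ^ q * a - d * x ^ q) + c ^ N * (d * x ^ q) := by ring
      rw [this]
      exact add_mem hN (mul_mem (pow_mem (hinv c hcinv) _) (mul_mem (hinv d hdinv) (pow_mem hxm _)))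

/-- A non-invariant element is transcendental over the ring of invariants. -/
theorem transcendental_of_notMem [IsDomain A] (φ : ExpMap k A) {x : A} (hx : x ∉ φ.invariants) :
    Transcendental φ.invariants x := by
  rw [transcendental_iff]
  intro P hP
  by_contra hP0
  have hdeg : 0 < (φ.toFun x).natDegree :=
    Nat.pos_of_ne_zero fun h => hx (φ.mem_invariants_iff_natDegree.2 h)
  have h1 : (P.map ((Polynomial.C : A →+* Polynomial A).comp
      (algebraMap φ.invariants A))).eval (φ.toFun x) = 0 := by
    rw [Polynomial.eval_map, ← map_zero φ.toFun, ← hP, Polynomial.aeval_def]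
    change _ = φ.toFun.toRingHom _
    rw [Polynomial.hom_eval₂]
    congr 1
    ext1 b
    exact (φ.mem_invariants_iff.1 b.2).symm
  have h2 : (P.map (algebraMap φ.invariants A)).comp (φ.toFun x) = 0 := by
    rw [Polynomial.comp, Polynomial.eval₂_map, ← Polynomial.eval_map]
    exact h1
  have h3 : (P.map (algebraMap φ.invariants A)) ≠ 0 :=
    (Polynomial.map_ne_zero_iff Subtype.val_injective).2 hP0
  rcases Polynomial.comp_eq_zero_iff.1 h2 with h | ⟨-, h⟩
  · exact h3 h
  · rw [h, Polynomial.natDegree_C] at hdeg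
    exact hdeg.ne rfl

end ExpMap

section PrimeFibre

variable [IsAlgClosed k]

theorem Prime.exists_dvd_sub_algebraMap_of_dvd_aeval {q x : A} (hq : Prime q)
    {R : Polynomial k} (hR : R ≠ 0) (h : q ∣ Polynomial.aeval x R) :
    ∃ μ : k, q ∣ x - algebraMap k A μ := by
  rw [(IsAlgClosed.splits R).eq_prod_roots, map_mul, map_multiset_prod, Multiset.map_map] at h
  rcases hq.dvd_or_dvd h with h | h
  · rw [Polynomial.aeval_C] at h
    exact absurd (isUnit_of_dvd_unit h
      ((IsUnit.mk0 _ (Polynomial.leadingCoeff_ne_zero.2 hR)).map _)) hq.not_isUnit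
  · obtain ⟨μ, -, hμ⟩ := hq.exists_mem_multiset_map_dvd h
    exact ⟨μ, by simpa using hμ⟩

theorem Prime.exists_dvd_sub_algebraMap_of_isAlgebraic [IsDomain A] {q x : A} (hq : Prime q)
    (h : IsAlgebraic (Algebra.adjoin k {x}) q) : ∃ μ : k, q ∣ x - algebraMap k A μ := by
  obtain ⟨P, hP0, hP⟩ :=
    h.exists_nonzero_coeff_and_aeval_eq_zero (mem_nonZeroDivisors_of_ne_zero hq.ne_zero)
  obtain ⟨R, hR⟩ : ∃ R : Polynomial k, Polynomial.aeval x R = (P.coeff 0 : A) := by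
    have h0 : ∀ b ∈ Algebra.adjoin k {x}, ∃ R : Polynomial k, Polynomial.aeval x R = b := by
      rw [Algebra.adjoin_singleton_eq_range_aeval]
      exact fun b hb => hb
    exact h0 _ (P.coeff 0).2
  refine hq.exists_dvd_sub_algebraMap_of_dvd_aeval (R := R) ?_ ?_
  · rintro rfl
    rw [map_zero] at hR
    exact hP0 (Subtype.ext hR.symm)
  · rw [hR]
    rw [← Polynomial.divX_mul_X_add P, map_add, map_mul, Polynomial.aeval_X,
      Polynomial.aeval_C] at hP
    exact (dvd_add_right (dvd_mul_left q _)).1 (hP ▸ dvd_zero q)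

end PrimeFibre

theorem Subalgebra.transcendental_of_le {B C : Subalgebra k A} (hBC : B ≤ C) {x : A}
    (hx : Transcendental C x) : Transcendental B x := by
  let := (Subalgebra.inclusion hBC).toRingHom.toAlgebra
  have : IsScalarTower B C A := IsScalarTower.of_algebraMap_eq fun _ => rfl
  exact hx.restrictScalars (Subalgebra.inclusion_injective hBC)

theorem Subalgebra.adjoin_eq_top_of_adjoin_eq_top {B : Subalgebra k A} {x : A} {s : Set A}
    (h : Algebra.adjoin B {x} = ⊤) (hB : B ≤ Algebra.adjoin k s) (hx : x ∈ s) :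
    Algebra.adjoin k s = ⊤ := by
  rw [eq_top_iff]
  rintro a -
  have ha : a ∈ Algebra.adjoin B {x} := h ▸ Algebra.mem_top
  induction ha using Algebra.adjoin_induction with
  | mem y hy => rw [Set.mem_singleton_iff.1 hy]; exact Algebra.subset_adjoin hx
  | algebraMap b => exact hB b.2
  | add y z _ _ h1 h2 => exact add_mem h1 h2
  | mul y z _ _ h1 h2 => exact mul_mem h1 h2

namespace ExpMap

theorem mem_invariants_of_mul_mem [IsDomain A] (φ : ExpMap k A) {a b : A} (ha : a ≠ 0)
    (h : a * b ∈ φ.invariants) : b ∈ φ.invariants := by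
  rcases eq_or_ne b 0 with rfl | hb
  · exact zero_mem _
  · exact φ.mem_invariants_of_dvd (dvd_mul_left b a) (mul_ne_zero ha hb) h

/-- If the transcendence degree is at most two, residues of invariants modulo an invariant prime
are constants. -/
theorem exists_dvd_sub_algebraMap [IsAlgClosed k] [IsDomain A] {φ : ExpMap k A}
    (hφ : φ.Nontrivial) (htr : Algebra.trdeg k A ≤ 2) {q h : A} (hq : Prime q)
    (hqi : q ∈ φ.invariants) (hhi : h ∈ φ.invariants) : ∃ μ : k, q ∣ h - algebraMap k A μ := by
  by_cases hh : IsAlgebraic k h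
  · obtain ⟨R, hR, hRh⟩ := hh
    exact hq.exists_dvd_sub_algebraMap_of_dvd_aeval hR (hRh ▸ dvd_zero q)
  refine hq.exists_dvd_sub_algebraMap_of_isAlgebraic ?_
  by_contra hqt
  obtain ⟨x, hx⟩ := hφ
  have h1 : AlgebraicIndependent k (fun _ : Unit => h) :=
    algebraicIndependent_unique_type_iff.2 hh
  have h2 : AlgebraicIndependent k (fun o : Option Unit => o.elim q fun _ => h) := by
    rw [h1.option_iff_transcendental, Set.range_const]
    exact hqt
  have h3 : AlgebraicIndependent k
      (fun o : Option (Option Unit) => o.elim x fun o : Option Unit => o.elim q fun _ => h) := by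
    rw [h2.option_iff_transcendental]
    refine Subalgebra.transcendental_of_le (Algebra.adjoin_le ?_) (φ.transcendental_of_notMem hx)
    rintro _ ⟨_ | _, rfl⟩
    · exact hqi
    · exact hhi
  have h4 := h3.lift_cardinalMk_le_trdeg
  simp only [Cardinal.mk_fintype, Fintype.card_option, Fintype.card_unit,
    Cardinal.lift_natCast] at h4
  have h5 := h4.trans (Cardinal.lift_le.2 htr)
  rw [Cardinal.lift_ofNat] at h5
  norm_num at h5

theorem mem_adjoin_of_prime_mul_mem [IsAlgClosed k] [IsDomain A] {φ : ExpMap k A}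
    (hφ : φ.Nontrivial) (htr : Algebra.trdeg k A ≤ 2) {q x a : A} (hq : Prime q)
    (hqi : q ∈ φ.invariants) (hx : ∀ μ : k, ¬ q ∣ x - algebraMap k A μ)
    (ha : q * a ∈ Algebra.adjoin φ.invariants {x}) : a ∈ Algebra.adjoin φ.invariants {x} := by
  have key : ∀ P : Polynomial φ.invariants, ∃ (R : Polynomial k) (E : Polynomial φ.invariants),
      P = R.map (algebraMap k φ.invariants) + Polynomial.C ⟨q, hqi⟩ * E := by
    intro P
    induction P using Polynomial.induction_on' with
    | add P Q hP hQ =>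
      obtain ⟨R, E, rfl⟩ := hP
      obtain ⟨R', E', rfl⟩ := hQ
      exact ⟨R + R', E + E', by rw [Polynomial.map_add]; ring⟩
    | monomial n b =>
      obtain ⟨μ, e, he⟩ := exists_dvd_sub_algebraMap hφ htr hq hqi b.2
      have hei : e ∈ φ.invariants := φ.mem_invariants_of_mul_mem hq.ne_zero
        (he ▸ sub_mem b.2 (Subalgebra.algebraMap_mem _ μ))
      refine ⟨Polynomial.monomial n μ, Polynomial.monomial n ⟨e, hei⟩, ?_⟩
      rw [Polynomial.map_monomial, Polynomial.C_mul_monomial, ← map_add]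
      congr 1
      exact Subtype.ext (sub_eq_iff_eq_add'.1 he)
  rw [Algebra.adjoin_singleton_eq_range_aeval] at ha ⊢
  obtain ⟨P, hP⟩ := ha
  obtain ⟨R, E, rfl⟩ := key P
  have hP' : Polynomial.aeval x R + q * Polynomial.aeval x E = q * a := by
    rw [← hP]
    change _ = Polynomial.aeval x _
    rw [map_add, map_mul, Polynomial.aeval_map_algebraMap, Polynomial.aeval_C]
    rfl
  have hR : R = 0 := by
    by_contra hR
    obtain ⟨μ, hμ⟩ := hq.exists_dvd_sub_algebraMap_of_dvd_aeval (x := x) hR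
      ((dvd_add_left (dvd_mul_right q _)).1 (hP' ▸ dvd_mul_right q a))
    exact hx μ hμ
  rw [hR, map_zero, zero_add] at hP'
  exact ⟨E, mul_left_cancel₀ hq.ne_zero hP'⟩

theorem mem_adjoin_of_mul_mem [IsAlgClosed k] [IsDomain A] [UniqueFactorizationMonoid A]
    {φ : ExpMap k A} (hφ : φ.Nontrivial) (htr : Algebra.trdeg k A ≤ 2) {d x a : A} (hd : d ≠ 0)
    (hdi : d ∈ φ.invariants)
    (hx : ∀ q, Prime q → q ∣ d → ∀ μ : k, ¬ q ∣ x - algebraMap k A μ)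
    (ha : d * a ∈ Algebra.adjoin φ.invariants {x}) : a ∈ Algebra.adjoin φ.invariants {x} := by
  induction d using UniqueFactorizationMonoid.induction_on_prime generalizing a with
  | h₁ => exact absurd rfl hd
  | h₂ u hu =>
    obtain ⟨v, hv⟩ := hu.exists_left_inv
    have hvi : v ∈ φ.invariants :=
      φ.mem_invariants_of_dvd (Dvd.intro u hv) one_ne_zero (one_mem _)
    have := mul_mem (Subalgebra.algebraMap_mem (Algebra.adjoin φ.invariants {x})
      (⟨v, hvi⟩ : φ.invariants)) ha
    change v * (u * a) ∈ _ at this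
    rwa [← mul_assoc, hv, one_mul] at this
  | h₃ d q hd0 hq ih =>
    have hqi := φ.mem_invariants_of_dvd (dvd_mul_right q d) hd hdi
    refine ih hd0 (φ.mem_invariants_of_dvd (dvd_mul_left d q) hd hdi)
      (fun p hp hpd => hx p hp (hpd.mul_left q)) ?_
    refine mem_adjoin_of_prime_mul_mem hφ htr hq hqi (hx q hq (dvd_mul_right q d)) ?_
    rwa [← mul_assoc]

/-- Over an algebra of transcendence degree two, a suitable minimal-degree element generates the
algebra over the invariants. -/
theorem IsMinDegree.adjoin_eq_top [IsAlgClosed k] [IsDomain A] [UniqueFactorizationMonoid A]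
    {φ : ExpMap k A} {n : ℕ} (hn : φ.IsMinDegree n) (htr : Algebra.trdeg k A ≤ 2) {x : A}
    (hx : (φ.toFun x).natDegree = n)
    (hxq : ∀ q, Prime q → q ∣ (φ.toFun x).leadingCoeff → ∀ μ : k, ¬ q ∣ x - algebraMap k A μ) :
    Algebra.adjoin φ.invariants {x} = ⊤ := by
  have hxi : x ∉ φ.invariants := by
    rw [mem_invariants_iff_natDegree, hx]; exact hn.1.1.ne'
  have hx0 : x ≠ 0 := fun h => hxi (h ▸ zero_mem _)
  rw [eq_top_iff]
  rintro a -
  obtain ⟨N, hN⟩ := hn.exists_pow_mul_mem_adjoin hx a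
  exact mem_adjoin_of_mul_mem ⟨x, hxi⟩ htr
    (pow_ne_zero N (Polynomial.leadingCoeff_ne_zero.2 (φ.toFun_ne_zero hx0)))
    (pow_mem (φ.leadingCoeff_mem_invariants x) N)
    (fun q hq hqd => hxq q hq (hq.dvd_of_dvd_pow hqd)) hN

/-- If `x - μ = q * y` with `q` invariant, then `q` times the leading coefficient of `φ y` is
that of `φ x`. -/
theorem natDegree_and_leadingCoeff_of_sub_eq_mul [IsDomain A] (φ : ExpMap k A) {q x y : A} {μ : k}
    (hx : x ∉ φ.invariants) (hq0 : q ≠ 0) (hq : q ∈ φ.invariants)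
    (h : x - algebraMap k A μ = q * y) :
    (φ.toFun y).natDegree = (φ.toFun x).natDegree ∧
      (φ.toFun x).leadingCoeff = q * (φ.toFun y).leadingCoeff := by
  have hdeg : 0 < (φ.toFun x).natDegree :=
    Nat.pos_of_ne_zero fun h => hx (φ.mem_invariants_iff_natDegree.2 h)
  have h1 : φ.toFun x = Polynomial.C q * φ.toFun y + Polynomial.C (algebraMap k A μ) := by
    rw [← φ.mem_invariants_iff.1 hq, ← φ.mem_invariants_iff.1 (φ.invariants.algebraMap_mem μ),
      ← map_mul, ← map_add, ← h, sub_add_cancel]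
  have h2 : (φ.toFun x).natDegree = (φ.toFun y).natDegree := by
    rw [h1, Polynomial.natDegree_add_C, Polynomial.natDegree_C_mul hq0]
  refine ⟨h2.symm, ?_⟩
  rw [Polynomial.leadingCoeff, Polynomial.leadingCoeff, ← h2, h1, Polynomial.coeff_add,
    Polynomial.coeff_C_mul, ← h1, Polynomial.coeff_C_of_ne_zero hdeg.ne', add_zero]

end ExpMap

namespace MvPolynomial

theorem isUnit_of_totalDegree_eq_zero {σ : Type*} {p : MvPolynomial σ k} (hp : p ≠ 0)
    (h : p.totalDegree = 0) : IsUnit p := by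
  rw [totalDegree_eq_zero_iff_eq_C] at h
  rw [h] at hp ⊢
  exact (IsUnit.mk0 _ fun h0 => hp (by rw [h0, C_0])).map C

theorem totalDegree_sub_algebraMap_le {σ : Type*} (p : MvPolynomial σ k) (μ : k) :
    (p - algebraMap k _ μ).totalDegree ≤ p.totalDegree := by
  refine (totalDegree_sub _ _).trans ?_
  rw [algebraMap_eq, totalDegree_C]
  simp

end MvPolynomial

namespace ExpMap

variable [IsAlgClosed k]

theorem exists_adjoin_eq_top {σ : Type*} {φ : ExpMap k (MvPolynomial σ k)} (hφ : φ.Nontrivial)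
    (htr : Algebra.trdeg k (MvPolynomial σ k) ≤ 2) :
    ∃ x : MvPolynomial σ k, Algebra.adjoin φ.invariants {x} = ⊤ := by
  obtain ⟨n, hn⟩ := exists_isMinDegree hφ
  obtain ⟨x, hx, hmin⟩ := (measure fun x => (φ.toFun x).leadingCoeff.totalDegree).wf.has_min
    {x | (φ.toFun x).natDegree = n} hn.1.2
  have hx : (φ.toFun x).natDegree = n := hx
  have hxi : x ∉ φ.invariants := by
    rw [mem_invariants_iff_natDegree, hx]; exact hn.1.1.ne'
  have hx0 : x ≠ 0 := fun h => hxi (h ▸ zero_mem _)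
  have hc0 := Polynomial.leadingCoeff_ne_zero.2 (φ.toFun_ne_zero hx0)
  refine ⟨x, hn.adjoin_eq_top htr hx ?_⟩
  rintro q hq hqd μ ⟨y, hy⟩
  have hqi := φ.mem_invariants_of_dvd hqd hc0 (φ.leadingCoeff_mem_invariants x)
  obtain ⟨h1, h2⟩ := φ.natDegree_and_leadingCoeff_of_sub_eq_mul hxi hq.ne_zero hqi hy
  refine hmin y (h1.trans hx) ?_
  change (φ.toFun y).leadingCoeff.totalDegree < (φ.toFun x).leadingCoeff.totalDegree
  have hy0 : (φ.toFun y).leadingCoeff ≠ 0 := right_ne_zero_of_mul (h2 ▸ hc0)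
  rw [h2, MvPolynomial.totalDegree_mul_of_isDomain hq.ne_zero hy0]
  have := mt (MvPolynomial.isUnit_of_totalDegree_eq_zero hq.ne_zero) hq.not_isUnit
  omega

theorem exists_invariants_eq_adjoin {σ : Type*} {φ : ExpMap k (MvPolynomial σ k)}
    (hφ : φ.Nontrivial) (htr : Algebra.trdeg k (MvPolynomial σ k) ≤ 2)
    (hne : ∃ b ∈ φ.invariants, b.totalDegree ≠ 0) :
    ∃ f, φ.invariants = Algebra.adjoin k {f} := by
  obtain ⟨f, ⟨hfi, hf0⟩, hmin⟩ := (measure fun b => b.totalDegree).wf.has_min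
    {b | b ∈ φ.invariants ∧ b.totalDegree ≠ 0} hne
  have hmin : ∀ b ∈ φ.invariants, b.totalDegree ≠ 0 → f.totalDegree ≤ b.totalDegree :=
    fun b hb hb0 => not_lt.1 (hmin b ⟨hb, hb0⟩)
  have hfne : f ≠ 0 := by
    rintro rfl
    exact hf0 MvPolynomial.totalDegree_zero
  have hprime : Prime f := by
    rw [← irreducible_iff_prime]
    refine ⟨fun hu => hf0 ?_, fun a b hab => ?_⟩
    · obtain ⟨g, hg⟩ := hu.exists_right_inv
      have hg0 : g ≠ 0 := right_ne_zero_of_mul (hg ▸ one_ne_zero)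
      have := congrArg MvPolynomial.totalDegree hg
      rw [MvPolynomial.totalDegree_mul_of_isDomain hfne hg0, MvPolynomial.totalDegree_one] at this
      omega
    · have ha0 : a ≠ 0 := left_ne_zero_of_mul (hab ▸ hfne)
      have hb0 : b ≠ 0 := right_ne_zero_of_mul (hab ▸ hfne)
      have hdeg := congrArg MvPolynomial.totalDegree hab
      rw [MvPolynomial.totalDegree_mul_of_isDomain ha0 hb0] at hdeg
      have ha := hmin a (φ.mem_invariants_of_dvd ⟨b, hab⟩ hfne hfi)
      by_cases hb : b.totalDegree = 0
      · exact Or.inr (MvPolynomial.isUnit_of_totalDegree_eq_zero hb0 hb)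
      · refine Or.inl (MvPolynomial.isUnit_of_totalDegree_eq_zero ha0 ?_)
        by_contra ha1
        have := ha ha1
        omega
  refine ⟨f, le_antisymm ?_ (Algebra.adjoin_le (Set.singleton_subset_iff.2 hfi))⟩
  intro h hh
  induction hm : h.totalDegree using Nat.strong_induction_on generalizing h with
  | _ m ih =>
    obtain ⟨μ, g, hg⟩ := exists_dvd_sub_algebraMap hφ htr hprime hfi hh
    have hgi : g ∈ φ.invariants := φ.mem_invariants_of_mul_mem hfne
      (hg ▸ sub_mem hh (Subalgebra.algebraMap_mem _ μ))
    rw [← sub_add_cancel h (algebraMap k _ μ), hg]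
    refine add_mem (mul_mem (Algebra.self_mem_adjoin_singleton k f) ?_)
      (Subalgebra.algebraMap_mem _ μ)
    rcases eq_or_ne g 0 with rfl | hg0
    · exact zero_mem _
    · refine ih _ ?_ hgi rfl
      have h1 := MvPolynomial.totalDegree_sub_algebraMap_le h μ
      rw [hg, MvPolynomial.totalDegree_mul_of_isDomain hfne hg0] at h1
      omega

end ExpMap

/-- Over an algebraically closed field `k`, the ring of invariants of any
nontrivial exponential map on `k[X,Y]` is `k[f]` for a coordinate `f`, i.e.
`k[X,Y] = k[f][g]` for some `g`. -/
theorem ker_exp_plane (K : Type*) [Field K] [IsAlgClosed K]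
    (φ : ExpMap K (MvPolynomial (Fin 2) K)) (hφ : φ.Nontrivial) :
    ∃ f g : MvPolynomial (Fin 2) K,
      φ.invariants = Algebra.adjoin K {f} ∧
      AlgebraicIndependent K ![f, g] ∧
      Algebra.adjoin K {f, g} = ⊤ := by
  have htr : Algebra.trdeg K (MvPolynomial (Fin 2) K) = 2 := by
    rw [MvPolynomial.trdeg_of_isDomain, Cardinal.mk_fin, Cardinal.lift_natCast, Nat.cast_ofNat]
  obtain ⟨g, hg⟩ := ExpMap.exists_adjoin_eq_top hφ htr.le
  have hne : ∃ b ∈ φ.invariants, b.totalDegree ≠ 0 := by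
    by_contra! h
    have htop : Algebra.adjoin K {g} = ⊤ := by
      refine Subalgebra.adjoin_eq_top_of_adjoin_eq_top hg (fun b hb => ?_)
        (Set.mem_singleton g)
      rw [MvPolynomial.totalDegree_eq_zero_iff_eq_C.1 (h b hb)]
      exact Subalgebra.algebraMap_mem _ _
    have : Algebra.IsAlgebraic (Algebra.adjoin K {g}) (MvPolynomial (Fin 2) K) :=
      ⟨fun a => isAlgebraic_algebraMap (⟨a, htop ▸ Algebra.mem_top⟩ : Algebra.adjoin K {g})⟩
    have := Algebra.IsAlgebraic.trdeg_le_cardinalMk K ({g} : Set (MvPolynomial (Fin 2) K))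
    rw [htr, Cardinal.mk_singleton] at this
    norm_num at this
  obtain ⟨f, hf⟩ := ExpMap.exists_invariants_eq_adjoin hφ htr.le hne
  have htop : Algebra.adjoin K {f, g} = ⊤ :=
    Subalgebra.adjoin_eq_top_of_adjoin_eq_top hg
      (hf ▸ Algebra.adjoin_mono (Set.singleton_subset_iff.2 (Set.mem_insert f {g})))
      (Set.mem_insert_of_mem f rfl)
  refine ⟨f, g, hf, ?_, htop⟩
  have hrange : Algebra.adjoin K (Set.range ![f, g]) = ⊤ := by
    rw [Matrix.range_cons, Matrix.range_cons, Matrix.range_empty, Set.union_empty,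
      Set.singleton_union, htop]
  have : Algebra.IsAlgebraic (Algebra.adjoin K (Set.range ![f, g])) (MvPolynomial (Fin 2) K) :=
    ⟨fun a => isAlgebraic_algebraMap
      (⟨a, hrange ▸ Algebra.mem_top⟩ : Algebra.adjoin K (Set.range ![f, g]))⟩
  refine (Algebra.IsAlgebraic.isTranscendenceBasis_of_lift_le_trdeg_of_finite K ![f, g] ?_).1
  rw [htr, Cardinal.mk_fin]
  simp
end
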